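/- arXiv:2005.12960 — 3 statements merged into one kernel-verified Lean document; each statement's English description precedes it below -/
import Mathlib

section
/- Let H be a complex separable Hilbert space, let B be an invertible bounded linear operator on H, let C be a compact linear operator on H, and suppose A = B + C is invertible (bijective with bounded inverse). Let M ∈ [0,1] be such that ‖r_k^{B,z}‖ ≤ M·‖r_{k-1}^{B,z}‖ for every z ∈ H and every k ≥ 1. Then for every r0 ∈ H and every k ≥ 1, ‖r_k^{A,r0}‖ ≤ (∏_{j=1}^{k} (M + (1+M)·‖A⁻¹‖·σ_j(C)))·‖r0‖. -/
noncomputable def gmresRes {H : Type*} [NormedAddCommGroup H] [NormedSpace ℂ H]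
    (T : H →L[ℂ] H) (r0 : H) (k : ℕ) : ℝ :=
  sInf {x : ℝ | ∃ p : Polynomial ℂ,
    p.natDegree ≤ k ∧ p.eval 0 = 1 ∧ x = ‖(Polynomial.aeval T p) r0‖}

noncomputable def approxNum {H : Type*} [NormedAddCommGroup H] [NormedSpace ℂ H]
    (T : H →L[ℂ] H) (j : ℕ) : ℝ :=
  sInf {x : ℝ | ∃ F : H →L[ℂ] H,
    LinearMap.rank (F : H →ₗ[ℂ] H) < j ∧ x = ‖T - F‖}

open Module

theorem sv_le {k : ℕ} (N : EuclideanSpace ℂ (Fin k) →ₗ[ℂ] EuclideanSpace ℂ (Fin k))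
    (F : EuclideanSpace ℂ (Fin k) →ₗ[ℂ] EuclideanSpace ℂ (Fin k)) (j : Fin k) (d : ℝ) (hd : 0 ≤ d)
    (hF : finrank ℂ (LinearMap.range F) ≤ j) (h : ∀ x, ‖N x - F x‖ ≤ d * ‖x‖) :
    N.isSymmetric_adjoint_comp_self.eigenvalues (finrank_euclideanSpace_fin (𝕜 := ℂ)) j ≤ d ^ 2 := by
  set hs := N.isSymmetric_adjoint_comp_self
  set hn : finrank ℂ (EuclideanSpace ℂ (Fin k)) = k := finrank_euclideanSpace_fin
  set b := hs.eigenvectorBasis hn with hb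
  set U : Submodule ℂ (EuclideanSpace ℂ (Fin k)) :=
    Submodule.span ℂ (Set.range (fun i : Fin (j + 1) => b (Fin.castLE j.2 i))) with hU
  have hUr : finrank ℂ U = j + 1 := by
    have := finrank_span_eq_card (R := ℂ) (b := fun i : Fin ((j:ℕ) + 1) => b (Fin.castLE j.2 i))
      (b.orthonormal.linearIndependent.comp (Fin.castLE j.2) (Fin.castLE_injective _))
    simpa using this
  have hker : finrank ℂ (LinearMap.range F) + finrank ℂ (LinearMap.ker F) = k := by
    rw [LinearMap.finrank_range_add_finrank_ker, hn]
  have hne : U ⊓ LinearMap.ker F ≠ ⊥ := by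
    intro hbot
    have h1 := Submodule.finrank_sup_add_finrank_inf_eq U (LinearMap.ker F)
    rw [hbot, finrank_bot] at h1
    have h2 := Submodule.finrank_le (U ⊔ LinearMap.ker F)
    rw [hn] at h2
    omega
  obtain ⟨x, hx, hx0⟩ := Submodule.exists_mem_ne_zero_of_ne_bot hne
  obtain ⟨hxU, hxF⟩ := hx
  have hNx : ‖N x‖ ≤ d * ‖x‖ := by
    have := h x
    rwa [LinearMap.mem_ker.1 hxF, sub_zero] at this
  have hxi : ∀ i : Fin k, j < i → b.repr x i = 0 := by
    intro i hi
    rw [b.repr_apply_apply]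
    have : U ≤ (ℂ ∙ b i)ᗮ := by
      rw [hU, Submodule.span_le]
      rintro _ ⟨l, rfl⟩
      rw [SetLike.mem_coe, Submodule.mem_orthogonal_singleton_iff_inner_right]
      apply b.orthonormal.2
      intro h
      have := l.2
      rw [h] at hi
      simp [Fin.lt_def] at hi
      omega
    exact Submodule.mem_orthogonal_singleton_iff_inner_right.1 (this hxU)
  have e1 : ‖N x‖ ^ 2 = ∑ i, hs.eigenvalues hn i * ‖b.repr x i‖ ^ 2 := by
    have h1 : ((‖N x‖ ^ 2 : ℝ) : ℂ) = inner ℂ x ((LinearMap.adjoint N ∘ₗ N) x) := by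
      rw [LinearMap.comp_apply, LinearMap.adjoint_inner_right, inner_self_eq_norm_sq_to_K]
      simp
    have h2 : inner ℂ x ((LinearMap.adjoint N ∘ₗ N) x) =
      ((∑ i, hs.eigenvalues hn i * ‖b.repr x i‖ ^ 2 : ℝ) : ℂ) := by
      rw [← b.sum_inner_mul_inner, Complex.ofReal_sum]
      refine Finset.sum_congr rfl fun i _ => ?_
      have h3 := hs.eigenvectorBasis_apply_self_apply hn x i
      rw [← hb, b.repr_apply_apply] at h3
      rw [h3, ← inner_conj_symm, ← b.repr_apply_apply, Complex.ofReal_mul, Complex.ofReal_pow,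
        ← Complex.conj_mul']
      simp only [Complex.coe_algebraMap, RCLike.ofReal_eq_complex_ofReal]
      ring
    exact_mod_cast h1.trans h2
  have e2 : ‖x‖ ^ 2 = ∑ i, ‖b.repr x i‖ ^ 2 := by
    rw [← EuclideanSpace.norm_sq_eq, LinearIsometryEquiv.norm_map]
  have e3 : hs.eigenvalues hn j * ‖x‖ ^ 2 ≤ ‖N x‖ ^ 2 := by
    rw [e1, e2, Finset.mul_sum]
    refine Finset.sum_le_sum fun i _ => ?_
    by_cases hi : j < i
    · rw [hxi i hi]; simp
    · exact mul_le_mul_of_nonneg_right (hs.eigenvalues_antitone hn (not_lt.1 hi)) (sq_nonneg _)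
  have hxp : 0 < ‖x‖ ^ 2 := by positivity
  have : ‖N x‖ ^ 2 ≤ d ^ 2 * ‖x‖ ^ 2 := by rw [← mul_pow]; gcongr
  exact le_of_mul_le_mul_right (e3.trans this) hxp

theorem det_le {k : ℕ} (N : EuclideanSpace ℂ (Fin k) →ₗ[ℂ] EuclideanSpace ℂ (Fin k))
    (d : Fin k → ℝ) (hd : ∀ j, 0 ≤ d j)
    (h : ∀ j : Fin k, ∃ F : EuclideanSpace ℂ (Fin k) →ₗ[ℂ] EuclideanSpace ℂ (Fin k),
      finrank ℂ (LinearMap.range F) ≤ j ∧ ∀ x, ‖N x - F x‖ ≤ d j * ‖x‖) :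
    ‖LinearMap.det N‖ ≤ ∏ j, d j := by
  have h1 : LinearMap.det (LinearMap.adjoint N ∘ₗ N) = ((‖LinearMap.det N‖ ^ 2 : ℝ) : ℂ) := by
    rw [LinearMap.det_comp]
    have : LinearMap.det (LinearMap.adjoint N) = star (LinearMap.det N) := by
      have b := EuclideanSpace.basisFun (Fin k) ℂ
      rw [← LinearMap.det_toMatrix b.toBasis, LinearMap.toMatrix_adjoint,
        Matrix.det_conjTranspose, LinearMap.det_toMatrix]
    rw [this]
    simp [← Complex.conj_mul']
  rw [N.isSymmetric_adjoint_comp_self.det_eq_prod_eigenvalues (finrank_euclideanSpace_fin (𝕜 := ℂ))] at h1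
  have h2 : ‖LinearMap.det N‖ ^ 2 =
    ∏ i, N.isSymmetric_adjoint_comp_self.eigenvalues (finrank_euclideanSpace_fin (𝕜 := ℂ)) i := by
    apply Complex.ofReal_injective
    rw [← h1, Complex.ofReal_prod]
    rfl
  refine le_of_sq_le_sq ?_ (Finset.prod_nonneg fun j _ => hd j)
  rw [h2, ← Finset.prod_pow]
  refine Finset.prod_le_prod (fun i _ => N.isPositive_adjoint_comp_self.nonneg_eigenvalues _ i) ?_
  intro i _
  obtain ⟨F, hF, hF'⟩ := h i
  exact sv_le N F i (d i) (hd i) hF hF'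

theorem tri_bound {H : Type*} [NormedAddCommGroup H] [InnerProductSpace ℂ H]
    {k : ℕ} (w q : Fin k → H) (hw : Orthonormal ℂ w) (hq : Orthonormal ℂ q) (G : H →L[ℂ] H)
    (htri : ∀ i j, j < i → inner ℂ (q i) (G (w j)) = 0) (d : Fin k → ℝ)
    (h : ∀ j : Fin k, ∃ F : H →L[ℂ] H,
      LinearMap.rank (F : H →ₗ[ℂ] H) < ((j + 1 : ℕ) : Cardinal) ∧ ‖G - F‖ ≤ d j) :
    ∏ j, ‖inner ℂ (q j) (G (w j))‖ ≤ ∏ j, d j := by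
  let Wm : EuclideanSpace ℂ (Fin k) →ₗ[ℂ] H :=
    { toFun := fun x => ∑ j, x j • w j
      map_add' := by intro x y; simp [add_smul, Finset.sum_add_distrib]
      map_smul' := by intro c x; simp [Finset.smul_sum, mul_smul] }
  let Qm : H →ₗ[ℂ] EuclideanSpace ℂ (Fin k) :=
    { toFun := fun y => WithLp.toLp 2 (fun i => inner ℂ (q i) y)
      map_add' := by intro x y; ext i; simp [inner_add_right]
      map_smul' := by intro c x; ext i; simp [inner_smul_right] }
  have hWn : ∀ x, ‖Wm x‖ = ‖x‖ := by
    intro x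
    have h1 := hw.inner_sum (fun i => x i) (fun i => x i) Finset.univ
    change inner ℂ (Wm x : H) (Wm x : H) = _ at h1
    rw [← sq_eq_sq₀ (norm_nonneg _) (norm_nonneg _), EuclideanSpace.norm_sq_eq]
    rw [inner_self_eq_norm_sq_to_K] at h1
    simp_rw [Complex.conj_mul'] at h1
    apply Complex.ofReal_injective
    rw [Complex.ofReal_sum]
    simpa using h1
  have hQn : ∀ y, ‖Qm y‖ ≤ ‖y‖ := by
    intro y
    rw [← sq_le_sq₀ (norm_nonneg _) (norm_nonneg _), EuclideanSpace.norm_sq_eq]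
    exact hq.sum_inner_products_le y
  let N := Qm ∘ₗ (G : H →ₗ[ℂ] H) ∘ₗ Wm
  have hd : ∀ j, 0 ≤ d j := by
    intro j
    obtain ⟨F, -, hF⟩ := h j
    exact (norm_nonneg _).trans hF
  have key : ‖LinearMap.det N‖ ≤ ∏ j, d j := by
    apply det_le N d hd
    intro j
    obtain ⟨F, hF, hF'⟩ := h j
    refine ⟨Qm ∘ₗ (F : H →ₗ[ℂ] H) ∘ₗ Wm, ?_, ?_⟩
    · have h1 : LinearMap.rank (Qm ∘ₗ (F : H →ₗ[ℂ] H) ∘ₗ Wm) < ((j + 1 : ℕ) : Cardinal) := by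
        have h2 : LinearMap.rank ((F : H →ₗ[ℂ] H) ∘ₗ Wm) ≤ LinearMap.rank (F : H →ₗ[ℂ] H) :=
          LinearMap.rank_comp_le_left _ _
        have h3 := LinearMap.lift_rank_comp_le_right ((F : H →ₗ[ℂ] H) ∘ₗ Wm) Qm
        have h4 := (h3.trans (Cardinal.lift_le.2 h2)).trans_lt (Cardinal.lift_lt.2 hF)
        rw [Cardinal.lift_natCast] at h4
        simpa using h4
      have h2 : ((finrank ℂ (LinearMap.range (Qm ∘ₗ (F : H →ₗ[ℂ] H) ∘ₗ Wm)) : ℕ) : Cardinal)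
          < ((j + 1 : ℕ) : Cardinal) := by
        rw [finrank_eq_rank]; exact h1
      have := Nat.cast_lt.1 h2
      omega
    · intro x
      have : N x - (Qm ∘ₗ (F : H →ₗ[ℂ] H) ∘ₗ Wm) x = Qm ((G - F) (Wm x)) := by
        simp [N]
      rw [this]
      calc _ ≤ ‖(G - F) (Wm x)‖ := hQn _
        _ ≤ ‖G - F‖ * ‖Wm x‖ := (G - F).le_opNorm _
        _ ≤ d j * ‖x‖ := by rw [hWn]; gcongr
  have hdet : LinearMap.det N = ∏ j, inner ℂ (q j) (G (w j)) := by
    let b := (EuclideanSpace.basisFun (Fin k) ℂ).toBasis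
    have hent : ∀ i j, LinearMap.toMatrix b b N i j = inner ℂ (q i) (G (w j)) := by
      intro i j
      have : Wm (EuclideanSpace.single j 1) = w j := by
        simp [Wm, Finset.sum_ite_eq, ite_smul, Pi.single_apply]
      rw [LinearMap.toMatrix_apply]
      simp [b, N, this]
      rfl
    rw [← LinearMap.det_toMatrix b, Matrix.det_of_isUpperTriangular]
    · exact Finset.prod_congr rfl fun j _ => hent j j
    · intro i j hij
      rw [hent]
      exact htri i j hij
  rwa [hdet, norm_prod] at key

theorem area_aux {H : Type*} [NormedAddCommGroup H] [InnerProductSpace ℂ H] (r w : H)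
    (hw : w ≠ 0) :
    ‖r - (inner ℂ w r / (‖w‖ : ℂ) ^ 2) • w‖ ^ 2 * ‖w‖ ^ 2 =
      ‖r‖ ^ 2 * ‖w‖ ^ 2 - ‖(inner ℂ r w : ℂ)‖ ^ 2 := by
  have hwn : (‖w‖ : ℂ) ≠ 0 := by simpa using hw
  have h0 : inner ℂ w (r - (inner ℂ w r / (‖w‖ : ℂ) ^ 2) • w) = 0 := by
    rw [inner_sub_right, inner_smul_right, inner_self_eq_norm_sq_to_K]
    simp only [Complex.coe_algebraMap]
    field_simp
    simp
  have h1 : ((‖r - (inner ℂ w r / (‖w‖ : ℂ) ^ 2) • w‖ ^ 2 : ℝ) : ℂ) =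
      (‖r‖ : ℂ) ^ 2 - inner ℂ w r / (‖w‖ : ℂ) ^ 2 * inner ℂ r w := by
    have h2 := inner_self_eq_norm_sq_to_K (𝕜 := ℂ) (r - (inner ℂ w r / (‖w‖ : ℂ) ^ 2) • w)
    rw [inner_sub_left, inner_smul_left, h0, mul_zero, sub_zero, inner_sub_right,
      inner_self_eq_norm_sq_to_K, inner_smul_right] at h2
    simp only [Complex.coe_algebraMap] at h2
    rw [Complex.ofReal_pow, ← h2]
  apply Complex.ofReal_injective
  rw [Complex.ofReal_mul, h1, Complex.ofReal_sub, Complex.ofReal_mul, Complex.ofReal_pow,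
    Complex.ofReal_pow, Complex.ofReal_pow, ← Complex.conj_mul', inner_conj_symm]
  field_simp

theorem gmres_le_of_poly {H : Type*} [NormedAddCommGroup H] [NormedSpace ℂ H]
    (T : H →L[ℂ] H) (r0 : H) (k : ℕ) (p : Polynomial ℂ) (hp : p.natDegree ≤ k)
    (h0 : p.eval 0 = 1) : gmresRes T r0 k ≤ ‖(Polynomial.aeval T p) r0‖ := by
  apply csInf_le
  · refine ⟨0, ?_⟩
    rintro _ ⟨p, -, -, rfl⟩
    exact norm_nonneg _
  · exact ⟨p, hp, h0, rfl⟩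

theorem poly_of_mem {H : Type*} [NormedAddCommGroup H] [NormedSpace ℂ H]
    (T : H →L[ℂ] H) (r0 : H) (j : ℕ) (y : H)
    (hy : y ∈ Submodule.span ℂ ((fun i : ℕ => (T ^ i) r0) '' Set.Icc 1 j)) :
    ∃ p : Polynomial ℂ, p.natDegree ≤ j ∧ p.eval 0 = 0 ∧ (Polynomial.aeval T p) r0 = y := by
  induction hy using Submodule.span_induction with
  | mem x hx =>
    obtain ⟨i, hi, rfl⟩ := hx
    refine ⟨Polynomial.X ^ i, by simpa using hi.2, ?_, by simp⟩
    have : i ≠ 0 := by have := hi.1; omega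
    simp [this]
  | zero => exact ⟨0, by simp, by simp, by simp⟩
  | add x y _ _ h1 h2 =>
    obtain ⟨p, hp, hp0, hpx⟩ := h1
    obtain ⟨p', hp', hp0', hpx'⟩ := h2
    exact ⟨p + p', (Polynomial.natDegree_add_le _ _).trans (max_le hp hp'), by simp [hp0, hp0'],
      by simp [hpx, hpx']⟩
  | smul c x _ h1 =>
    obtain ⟨p, hp, hp0, hpx⟩ := h1
    exact ⟨c • p, (Polynomial.natDegree_smul_le _ _).trans hp, by simp [hp0], by simp [hpx]⟩

theorem no_annihilate {H : Type*} [NormedAddCommGroup H] [NormedSpace ℂ H]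
    (A : H ≃L[ℂ] H) (r0 : H) (k : ℕ)
    (hp : ∀ p : Polynomial ℂ, p.natDegree ≤ k → p.eval 0 = 1 →
      (Polynomial.aeval (A : H →L[ℂ] H) p) r0 ≠ 0)
    (g : Polynomial ℂ) (hg : g.natDegree ≤ k) (hg0 : g ≠ 0) :
    (Polynomial.aeval (A : H →L[ℂ] H) g) r0 ≠ 0 := by
  intro h0
  obtain ⟨h, hh, hd⟩ := Polynomial.exists_eq_pow_rootMultiplicity_mul_and_not_dvd g hg0 0
  set m := g.rootMultiplicity 0
  rw [Polynomial.dvd_iff_isRoot, Polynomial.IsRoot] at hd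
  simp only [Polynomial.C_0, sub_zero] at hh
  have hh0 : h ≠ 0 := by rintro rfl; simp at hd
  have hdeg : h.natDegree ≤ k := by
    have := congrArg Polynomial.natDegree hh
    rw [Polynomial.natDegree_mul (by simp) hh0] at this
    omega
  rw [hh, map_mul, map_pow, Polynomial.aeval_X, mul_apply_eq_comp] at h0
  have hinj : ∀ (n : ℕ) (y : H), ((A : H →L[ℂ] H) ^ n) y = 0 → y = 0 := by
    intro n
    induction n with
    | zero => intro y hy; simpa using hy
    | succ n ih =>
      intro y hy
      rw [pow_succ, mul_apply_eq_comp] at hy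
      have := ih _ hy
      simpa using this
  have h1 := hinj _ _ h0
  refine hp (Polynomial.C (h.eval 0)⁻¹ * h) ?_ ?_ ?_
  · exact (Polynomial.natDegree_C_mul_le _ _).trans hdeg
  · simp [hd]
  · rw [map_mul, mul_apply_eq_comp, h1, map_zero]

noncomputable def resSeq {H : Type*} [NormedAddCommGroup H] [InnerProductSpace ℂ H]
    (r0 : H) (w : ℕ → H) : ℕ → H
  | 0 => r0
  | (j + 1) => resSeq r0 w j - (inner ℂ (w j) (resSeq r0 w j) / (‖w j‖ : ℂ) ^ 2) • w j

theorem inner_eq_zero_of_span {H : Type*} [NormedAddCommGroup H] [InnerProductSpace ℂ H]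
    (S : Set H) (x y : H) (h : ∀ s ∈ S, inner ℂ x s = 0) (hy : y ∈ Submodule.span ℂ S) :
    inner ℂ x y = 0 := by
  have : Submodule.span ℂ S ≤ (ℂ ∙ x)ᗮ := by
    rw [Submodule.span_le]
    intro s hs
    exact Submodule.mem_orthogonal_singleton_iff_inner_right.2 (h s hs)
  exact Submodule.mem_orthogonal_singleton_iff_inner_right.1 (this hy)

theorem krylov {H : Type*} [NormedAddCommGroup H] [InnerProductSpace ℂ H]
    (A : H ≃L[ℂ] H) (r0 : H) (k : ℕ)
    (hp : ∀ p : Polynomial ℂ, p.natDegree ≤ k → p.eval 0 = 1 →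
      (Polynomial.aeval (A : H →L[ℂ] H) p) r0 ≠ 0) :
    ∃ w q : Fin k → H, Orthonormal ℂ w ∧ Orthonormal ℂ q ∧
      (∀ i j, j < i → inner ℂ (q i) (w j) = 0) ∧
      (∀ i j, j ≤ i → inner ℂ (q i) (A.symm (w j)) = 0) ∧
      gmresRes (A : H →L[ℂ] H) r0 k ≤ (∏ j, ‖(inner ℂ (q j) (w j) : ℂ)‖) * ‖r0‖ := by
  set a : ℕ → H := fun i => ((A : H →L[ℂ] H) ^ i) r0 with ha
  set w := InnerProductSpace.gramSchmidt ℂ (fun i => a (i + 1)) with hw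
  set r := resSeq r0 w with hr
  set q : ℕ → H := fun j => w j - (inner ℂ (r j) (w j) / (‖r j‖ : ℂ) ^ 2) • r j with hq
  have hr0 : r 0 = r0 := rfl
  have hrs : ∀ j, r (j + 1) = r j - (inner ℂ (w j) (r j) / (‖w j‖ : ℂ) ^ 2) • w j := fun j => rfl
  have hwU : ∀ j, w j ∈ Submodule.span ℂ (a '' Set.Icc 1 (j + 1)) := by
    intro j
    have h1 := InnerProductSpace.gramSchmidt_mem_span ℂ (fun i => a (i + 1)) (le_refl j)
    refine Submodule.span_mono ?_ h1
    rintro _ ⟨i, hi, rfl⟩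
    exact ⟨i + 1, ⟨by omega, by simpa using hi⟩, rfl⟩
  have hUw : ∀ j, Submodule.span ℂ (a '' Set.Icc 1 j) = Submodule.span ℂ (w '' Set.Iio j) := by
    intro j
    rw [hw, InnerProductSpace.span_gramSchmidt_Iio]
    congr 1
    ext x
    constructor
    · rintro ⟨i, hi, rfl⟩
      refine ⟨i - 1, ?_, ?_⟩
      · have := hi.1; have := hi.2; simp only [Set.mem_Iio]; omega
      · have := hi.1
        simp only []
        congr 1; omega
    · rintro ⟨i, hi, rfl⟩
      refine ⟨i + 1, ⟨by omega, by simpa using hi⟩, rfl⟩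
  have hUmono : ∀ i j, i ≤ j → Submodule.span ℂ (a '' Set.Icc 1 i) ≤
      Submodule.span ℂ (a '' Set.Icc 1 j) := by
    intro i j hij
    exact Submodule.span_mono (Set.image_mono (Set.Icc_subset_Icc_right hij))
  have hUK : ∀ j, Submodule.span ℂ (a '' Set.Icc 1 j) ≤ Submodule.span ℂ (a '' Set.Iic j) := by
    intro j
    exact Submodule.span_mono (Set.image_mono Set.Icc_subset_Iic_self)
  have hww : ∀ i j, i ≠ j → inner ℂ (w i) (w j) = 0 := fun i j h =>
    InnerProductSpace.gramSchmidt_orthogonal ℂ _ h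
  -- residual: orthogonality and membership
  have hrw : ∀ j i, i < j → inner ℂ (w i) (r j) = 0 := by
    intro j
    induction j with
    | zero => intro i hi; omega
    | succ j ih =>
      intro i hi
      rw [hrs, inner_sub_right, inner_smul_right]
      by_cases hij : i = j
      · subst hij
        by_cases hz : w i = 0
        · simp [hz]
        · have : (‖w i‖ : ℂ) ≠ 0 := by simpa using hz
          rw [inner_self_eq_norm_sq_to_K]
          simp only [Complex.coe_algebraMap]
          field_simp
          simp
      · rw [ih i (by omega), hww i j hij]; simp
  have hrU : ∀ j, r j - r0 ∈ Submodule.span ℂ (a '' Set.Icc 1 j) := by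
    intro j
    induction j with
    | zero => simp [hr0]
    | succ j ih =>
      rw [hrs, sub_right_comm]
      exact Submodule.sub_mem _ (hUmono _ _ (Nat.le_succ j) ih)
        (Submodule.smul_mem _ _ (hwU j))
  have hrpoly : ∀ j, ∃ p : Polynomial ℂ, p.natDegree ≤ j ∧ p.eval 0 = 1 ∧
      (Polynomial.aeval (A : H →L[ℂ] H) p) r0 = r j := by
    intro j
    obtain ⟨p, h1, h2, h3⟩ := poly_of_mem (A : H →L[ℂ] H) r0 j _ (hrU j)
    refine ⟨1 + p, ?_, by simp [h2], by simp [h3]⟩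
    exact (Polynomial.natDegree_add_le _ _).trans (max_le (by simp) h1)
  have hrne : ∀ j, j ≤ k → r j ≠ 0 := by
    intro j hj
    obtain ⟨p, h1, h2, h3⟩ := hrpoly j
    rw [← h3]
    exact hp p (h1.trans hj) h2
  have hwne : ∀ j, j < k → w j ≠ 0 := by
    intro j hj h0
    have h1 := InnerProductSpace.gramSchmidt_def' ℂ (fun i => a (i + 1)) j
    rw [← hw, h0, zero_add] at h1
    have h2 : a (j + 1) ∈ Submodule.span ℂ (a '' Set.Icc 1 j) := by
      rw [h1]
      refine Submodule.sum_mem _ fun i hi => ?_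
      rw [hUw]
      have : (ℂ ∙ w i) ≤ Submodule.span ℂ (w '' Set.Iio j) := by
        apply Submodule.span_mono
        rintro _ rfl
        exact ⟨i, by simpa using hi, rfl⟩
      exact this (Submodule.starProjection_apply_mem _ _)
    obtain ⟨p, h3, h4, h5⟩ := poly_of_mem (A : H →L[ℂ] H) r0 j _ h2
    have h6 : (Polynomial.X ^ (j + 1) - p).natDegree = j + 1 := by
      rw [Polynomial.natDegree_sub_eq_left_of_natDegree_lt] <;> simp
      omega
    refine no_annihilate A r0 k hp (Polynomial.X ^ (j + 1) - p) (by omega) ?_ ?_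
    · intro h; rw [h] at h6; simp at h6
    · rw [map_sub, sub_apply, h5]
      simp [ha]
  -- the q vectors
  have hqr : ∀ j, inner ℂ (q j) (r j) = 0 := by
    intro j
    rw [inner_eq_zero_symm]
    simp only [hq]
    rw [inner_sub_right, inner_smul_right]
    by_cases hz : r j = 0
    · simp [hz]
    · have : (‖r j‖ : ℂ) ≠ 0 := by simpa using hz
      rw [inner_self_eq_norm_sq_to_K]
      simp only [Complex.coe_algebraMap]
      field_simp
      simp
  have hqw : ∀ j i, i < j → inner ℂ (q j) (w i) = 0 := by
    intro j i hij
    rw [inner_eq_zero_symm]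
    simp only [hq]
    rw [inner_sub_right, inner_smul_right, hww i j hij.ne, hrw j i hij]
    simp
  have hqU : ∀ j y, y ∈ Submodule.span ℂ (a '' Set.Icc 1 j) → inner ℂ (q j) y = 0 := by
    intro j y hy
    rw [hUw] at hy
    refine inner_eq_zero_of_span _ _ _ ?_ hy
    rintro _ ⟨i, hi, rfl⟩
    exact hqw j i hi
  have hqa : ∀ j i, i ≤ j → inner ℂ (q j) (a i) = 0 := by
    intro j i hij
    rcases Nat.eq_zero_or_pos i with rfl | hi
    · have h1 : a 0 = r j - (r j - r0) := by simp [ha]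
      rw [h1, inner_sub_right, hqr, hqU j _ (hrU j), sub_zero]
    · exact hqU j _ (Submodule.subset_span ⟨i, ⟨hi, hij⟩, rfl⟩)
  have hqK : ∀ j y, y ∈ Submodule.span ℂ (a '' Set.Iic j) → inner ℂ (q j) y = 0 := by
    intro j y hy
    refine inner_eq_zero_of_span _ _ _ ?_ hy
    rintro _ ⟨i, hi, rfl⟩
    exact hqa j i hi
  have hKmono : ∀ i j, i ≤ j → Submodule.span ℂ (a '' Set.Iic i) ≤
      Submodule.span ℂ (a '' Set.Iic j) := by
    intro i j hij
    exact Submodule.span_mono (Set.image_mono (Set.Iic_subset_Iic.2 hij))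
  have hrK : ∀ j, r j ∈ Submodule.span ℂ (a '' Set.Iic j) := by
    intro j
    have : r j = (r j - r0) + a 0 := by simp [ha]
    rw [this]
    exact Submodule.add_mem _ (hUK j (hrU j)) (Submodule.subset_span ⟨0, by simp, rfl⟩)
  have hqmem : ∀ j, q j ∈ Submodule.span ℂ (a '' Set.Iic (j + 1)) := by
    intro j
    exact Submodule.sub_mem _ (hUK _ (hwU j))
      (Submodule.smul_mem _ _ (hKmono _ _ (Nat.le_succ j) (hrK j)))
  have hqq : ∀ i j, i ≠ j → inner ℂ (q i) (q j) = 0 := by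
    have : ∀ i j, j < i → inner ℂ (q i) (q j) = 0 := fun i j hij =>
      hqK i _ (hKmono _ _ hij (hqmem j))
    intro i j hij
    rcases lt_or_gt_of_ne hij with h | h
    · exact inner_eq_zero_symm.1 (this j i h)
    · exact this i j h
  have hAw : ∀ j, A.symm (w j) ∈ Submodule.span ℂ (a '' Set.Iic j) := by
    intro j
    have : Submodule.span ℂ (a '' Set.Icc 1 (j + 1)) ≤
        (Submodule.span ℂ (a '' Set.Iic j)).comap (A.symm : H →L[ℂ] H).toLinearMap := by
      rw [Submodule.span_le]
      rintro _ ⟨i, hi, rfl⟩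
      obtain ⟨l, rfl⟩ : ∃ l, i = l + 1 := ⟨i - 1, by have := hi.1; omega⟩
      refine Submodule.subset_span ⟨l, by simpa using hi.2, ?_⟩
      simp only [ha, pow_succ', mul_apply_eq_comp]
      exact (A.symm_apply_apply _).symm
    exact this (hwU j)
  have hqwself : ∀ j, inner ℂ (q j) (w j) = (‖q j‖ : ℂ) ^ 2 := by
    intro j
    have h1 : w j = q j + (inner ℂ (r j) (w j) / (‖r j‖ : ℂ) ^ 2) • r j := by simp [hq]
    rw [h1, inner_add_right, inner_smul_right, hqr, inner_self_eq_norm_sq_to_K]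
    simp
  have harea : ∀ j, j < k → ‖r (j + 1)‖ * ‖w j‖ = ‖r j‖ * ‖q j‖ := by
    intro j hj
    have h1 := area_aux (r j) (w j) (hwne j hj)
    have h2 := area_aux (w j) (r j) (hrne j hj.le)
    rw [← hrs] at h1
    change ‖q j‖ ^ 2 * _ = _ at h2
    rw [← sq_eq_sq₀ (by positivity) (by positivity), mul_pow, mul_pow, h1, mul_comm (‖r j‖ ^ 2) (‖q j‖ ^ 2), h2,
      norm_inner_symm]
    ring
  have hqne : ∀ j, j < k → q j ≠ 0 := by
    intro j hj h0
    have h1 := harea j hj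
    rw [h0, norm_zero, mul_zero] at h1
    have h2 := norm_pos_iff.2 (hrne (j + 1) hj)
    have h3 := norm_pos_iff.2 (hwne j hj)
    have := mul_pos h2 h3
    linarith
  refine ⟨fun j => ((‖w j‖ : ℂ)⁻¹) • w j, fun j => ((‖q j‖ : ℂ)⁻¹) • q j, ?_, ?_, ?_, ?_, ?_⟩
  · constructor
    · intro j
      have := norm_ne_zero_iff.2 (hwne j j.2)
      simp [norm_smul, this]
    · intro i j hij
      rw [inner_smul_left, inner_smul_right, hww _ _ (by simpa [Fin.ext_iff] using hij)]
      simp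
  · constructor
    · intro j
      have := norm_ne_zero_iff.2 (hqne j j.2)
      simp [norm_smul, this]
    · intro i j hij
      rw [inner_smul_left, inner_smul_right, hqq _ _ (by simpa [Fin.ext_iff] using hij)]
      simp
  · intro i j hij
    rw [inner_smul_left, inner_smul_right, hqw _ _ hij]
    simp
  · intro i j hij
    rw [map_smul, inner_smul_left, inner_smul_right, hqK i _ (hKmono j i hij (hAw j))]
    simp
  · have hterm : ∀ j : ℕ, j < k → ‖(inner ℂ (((‖q j‖ : ℂ)⁻¹) • q j) (((‖w j‖ : ℂ)⁻¹) • w j) : ℂ)‖ =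
        ‖r (j + 1)‖ / ‖r j‖ := by
      intro j hj
      have h1 := norm_ne_zero_iff.2 (hqne j hj)
      have h2 := norm_ne_zero_iff.2 (hwne j hj)
      have h3 := norm_ne_zero_iff.2 (hrne j hj.le)
      rw [inner_smul_left, inner_smul_right, hqwself]
      simp only [norm_mul, norm_inv, norm_pow, RCLike.norm_conj, Complex.norm_real, norm_norm]
      have := harea j hj
      field_simp
      linarith
    have hprod : ∀ n, n ≤ k → (∏ j ∈ Finset.range n, ‖r (j + 1)‖ / ‖r j‖) * ‖r0‖ = ‖r n‖ := by
      intro n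
      induction n with
      | zero => intro _; simp [hr0]
      | succ n ih =>
        intro hn
        have h3 := norm_ne_zero_iff.2 (hrne n (by omega))
        rw [Finset.prod_range_succ, mul_right_comm, ih (by omega)]
        field_simp
    rw [Finset.prod_congr rfl (fun (j : Fin k) _ => hterm j j.2),
      Fin.prod_univ_eq_prod_range (fun j => ‖r (j + 1)‖ / ‖r j‖), hprod k le_rfl]
    obtain ⟨p, h1, h2, h3⟩ := hrpoly k
    rw [← h3]
    exact gmres_le_of_poly _ _ _ p h1 h2

theorem th_aux {V : Type*} [NormedAddCommGroup V] [InnerProductSpace ℂ V] (X : V →ₗ[ℂ] V)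
    (z1 z2 : V) (c : ℝ) (hc : 0 < c) (h1 : inner ℂ z1 (X z1) = (1 : ℂ))
    (h2 : inner ℂ z2 (X z2) = -(c : ℂ)) :
    ∃ y : ℂ, z1 + y • z2 ≠ 0 ∧ inner ℂ (z1 + y • z2) (X (z1 + y • z2)) = 0 := by
  set a : ℂ := inner ℂ z1 (X z2)
  set b : ℂ := inner ℂ z2 (X z1)
  obtain ⟨e, he, ρ, hρ⟩ : ∃ e : ℂ, starRingEnd ℂ e * e = 1 ∧ ∃ ρ : ℝ,
      e * a + starRingEnd ℂ e * b = ρ := by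
    set d : ℂ := a - starRingEnd ℂ b with hd
    by_cases hd0 : d = 0
    · refine ⟨1, by simp, 2 * a.re, ?_⟩
      have : b = starRingEnd ℂ a := by
        rw [sub_eq_zero.1 hd0]; simp
      rw [this]
      simp [Complex.add_conj]
    · have hdn : (‖d‖ : ℂ) ≠ 0 := by simpa using hd0
      have hdd := Complex.conj_mul' d
      refine ⟨starRingEnd ℂ d / ‖d‖, ?_, ?_⟩
      · simp only [map_div₀, Complex.conj_conj, Complex.conj_ofReal]
        field_simp
        rw [← hdd]; ring
      · refine ⟨‖d‖ + 2 * (starRingEnd ℂ b * starRingEnd ℂ d / ‖d‖).re, ?_⟩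
        have ha : a = d + starRingEnd ℂ b := by rw [hd]; ring
        have h3 := Complex.add_conj (starRingEnd ℂ b * starRingEnd ℂ d / ‖d‖)
        simp only [map_div₀, map_mul, Complex.conj_conj, Complex.conj_ofReal] at h3 ⊢
        push_cast at h3 ⊢
        rw [← h3, ha]
        field_simp
        rw [← hdd]; ring
  set τ : ℝ := (ρ + √(ρ ^ 2 + 4 * c)) / (2 * c) with hτ
  have hroot : 1 + τ * ρ - τ ^ 2 * c = 0 := by
    have hs := Real.sq_sqrt (show 0 ≤ ρ ^ 2 + 4 * c by positivity)
    rw [hτ]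
    field_simp
    linear_combination -hs
  have hval : inner ℂ (z1 + (τ * e : ℂ) • z2) (X (z1 + (τ * e : ℂ) • z2)) = 0 := by
    have hr' : (1 + τ * ρ - τ ^ 2 * c : ℂ) = 0 := by exact_mod_cast hroot
    rw [map_add, map_smul, inner_add_left, inner_add_right, inner_add_right, inner_smul_left,
      inner_smul_left, inner_smul_right, inner_smul_right, h1, h2, map_mul, Complex.conj_ofReal]
    change 1 + τ * e * a + (τ * starRingEnd ℂ e * b + τ * starRingEnd ℂ e * (τ * e * (-c))) = 0
    linear_combination hr' + τ * hρ - τ ^ 2 * c * he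
  refine ⟨τ * e, ?_, hval⟩
  intro h0
  have hz : z1 = -((τ * e : ℂ) • z2) := eq_neg_of_add_eq_zero_left h0
  rw [hz, map_neg, map_smul, inner_neg_neg, inner_smul_left, inner_smul_right, h2, map_mul,
    Complex.conj_ofReal] at h1
  have h3 : (-(τ ^ 2 * c) : ℂ) = 1 := by
    rw [← h1]; linear_combination (τ ^ 2 * c : ℂ) * he
  have h4 : -(τ ^ 2 * c) = 1 := by exact_mod_cast h3
  nlinarith [sq_nonneg τ, mul_nonneg (sq_nonneg τ) hc.le]

theorem th_convex {V : Type*} [NormedAddCommGroup V] [InnerProductSpace ℂ V] (X : V →ₗ[ℂ] V)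
    (Z : Submodule ℂ V) :
    Convex ℝ ((fun z : V => (inner ℂ z (X z) : ℂ)) '' {z | z ∈ Z ∧ ‖z‖ = 1}) := by
  rw [convex_iff_forall_pos]
  rintro _ ⟨z1, ⟨hz1, hn1⟩, rfl⟩ _ ⟨z2, ⟨hz2, hn2⟩, rfl⟩ s t hs ht hst
  simp only []
  set w1 : ℂ := inner ℂ z1 (X z1) with hw1
  set w2 : ℂ := inner ℂ z2 (X z2) with hw2
  set c : ℂ := s • w1 + t • w2 with hc
  have hc' : c = s * w1 + t * w2 := by simp [hc]
  by_cases h0 : w1 - c = 0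
  · exact ⟨z1, ⟨hz1, hn1⟩, sub_eq_zero.1 h0⟩
  have hsum : (s : ℂ) * (w1 - c) + t * (w2 - c) = 0 := by
    have : (s : ℂ) + t = 1 := by exact_mod_cast hst
    linear_combination -hc' - c * this
  have hs0 : (s : ℂ) ≠ 0 := by exact_mod_cast hs.ne'
  have ht0 : (t : ℂ) ≠ 0 := by exact_mod_cast ht.ne'
  obtain ⟨y, hy, hy0⟩ := th_aux ((w1 - c)⁻¹ • (X - c • LinearMap.id)) z1 z2 (s / t)
    (by positivity) (by
      simp only [LinearMap.smul_apply, LinearMap.sub_apply, LinearMap.id_apply, inner_smul_right,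
        inner_sub_right, inner_self_eq_norm_sq_to_K, hn1, ← hw1]
      simp [h0]) (by
      simp only [LinearMap.smul_apply, LinearMap.sub_apply, LinearMap.id_apply, inner_smul_right,
        inner_sub_right, inner_self_eq_norm_sq_to_K, hn2, ← hw2]
      push_cast
      simp
      field_simp
      linear_combination hsum)
  set z := z1 + y • z2
  have hzZ : z ∈ Z := Z.add_mem hz1 (Z.smul_mem _ hz2)
  have hzn : (‖z‖ : ℂ) ≠ 0 := by simpa using hy
  have hfz : inner ℂ z (X z) = c * (‖z‖ : ℂ) ^ 2 := by
    simp only [LinearMap.smul_apply, LinearMap.sub_apply, LinearMap.id_apply, inner_smul_right,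
        inner_sub_right, inner_self_eq_norm_sq_to_K] at hy0
    rcases mul_eq_zero.1 hy0 with h | h
    · exact absurd (inv_eq_zero.1 h) h0
    · simpa using sub_eq_zero.1 h
  refine ⟨(‖z‖ : ℂ)⁻¹ • z, ⟨Z.smul_mem _ hzZ, ?_⟩, ?_⟩
  · have : ‖z‖ ≠ 0 := norm_ne_zero_iff.2 hy
    simp [norm_smul, this]
  · simp only []
    rw [map_smul, inner_smul_left, inner_smul_right, hfz, map_inv₀, Complex.conj_ofReal]
    field_simp

theorem norm_attained {V H : Type*} [NormedAddCommGroup V] [InnerProductSpace ℂ V]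
    [NormedAddCommGroup H] [InnerProductSpace ℂ H] [FiniteDimensional ℂ V] [Nontrivial V]
    (T : V →L[ℂ] H) : ∃ z : V, ‖z‖ = 1 ∧ ‖T z‖ = ‖T‖ := by
  haveI : ProperSpace V := FiniteDimensional.proper ℂ V
  letI : NormedSpace ℝ V := NormedSpace.restrictScalars ℝ ℂ V
  obtain ⟨z, hz, hmax⟩ := (isCompact_sphere (0 : V) 1).exists_isMaxOn
    (NormedSpace.sphere_nonempty.2 zero_le_one) (f := fun z => ‖T z‖) (by fun_prop)
  have hz1 : ‖z‖ = 1 := by simpa using hz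
  refine ⟨z, hz1, le_antisymm ?_ ?_⟩
  · simpa [hz1] using T.le_opNorm z
  · refine T.opNorm_le_bound (norm_nonneg _) fun x => ?_
    by_cases hx : x = 0
    · simp [hx]
    have hxn : ‖x‖ ≠ 0 := norm_ne_zero_iff.2 hx
    have h1 : ((‖x‖ : ℂ)⁻¹ • x) ∈ Metric.sphere (0 : V) 1 := by simp [norm_smul, hxn]
    have h2 : ‖T ((‖x‖ : ℂ)⁻¹ • x)‖ ≤ ‖T z‖ := hmax h1
    rw [map_smul, norm_smul, norm_inv, Complex.norm_real, norm_norm] at h2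
    rwa [inv_mul_le_iff₀ (by positivity), mul_comm] at h2

theorem minimax_fin {V H : Type*} [NormedAddCommGroup V] [InnerProductSpace ℂ V]
    [NormedAddCommGroup H] [InnerProductSpace ℂ H] [CompleteSpace H]
    [FiniteDimensional ℂ V] [Nontrivial V] (E0 S : V →L[ℂ] H) (hS : S ≠ 0) :
    ∃ (s : ℂ) (z : V), ‖z‖ = 1 ∧ ‖(E0 - s • S) z‖ = ‖E0 - s • S‖ ∧
      inner ℂ (S z) ((E0 - s • S) z) = 0 := by
  haveI : ProperSpace V := FiniteDimensional.proper ℂ V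
  haveI : CompleteSpace V := FiniteDimensional.complete ℂ V
  obtain ⟨s, hs⟩ : ∃ s : ℂ, ∀ t : ℂ, ‖E0 - s • S‖ ≤ ‖E0 - t • S‖ := by
    have hcont : Continuous fun s : ℂ => ‖E0 - s • S‖ := by fun_prop
    apply hcont.exists_forall_le
    have hSp : 0 < ‖S‖ := norm_pos_iff.2 hS
    have h1 : Filter.Tendsto (fun s : ℂ => ‖s‖ * ‖S‖ - ‖E0‖) (Filter.cocompact ℂ) Filter.atTop :=
      Filter.tendsto_atTop_add_const_right _ _
        ((tendsto_norm_cocompact_atTop).atTop_mul_const hSp)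
    refine Filter.tendsto_atTop_mono (fun s => ?_) h1
    rw [← norm_smul]
    have := norm_sub_norm_le (s • S) E0
    rwa [norm_sub_rev] at this
  set E := E0 - s • S with hE
  set m := ‖E‖ with hm
  by_contra hcon
  push Not at hcon
  have hcon' : ∀ z : V, ‖z‖ = 1 → ‖E z‖ = m → inner ℂ (S z) (E z) ≠ 0 := fun z => hcon s z
  -- the maximal subspace
  let P : V →L[ℂ] V := ((m : ℂ) ^ 2) • ContinuousLinearMap.id ℂ V - E.adjoint ∘L E
  let Z : Submodule ℂ V := LinearMap.ker P.toLinearMap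
  have hZ : ∀ z, z ∈ Z ↔ ‖E z‖ = m * ‖z‖ := by
    intro z
    have hP : P z = ((m : ℂ) ^ 2) • z - E.adjoint (E z) := by simp [P]
    have hm0 : 0 ≤ m := norm_nonneg _
    have hEz : ‖E z‖ ≤ m * ‖z‖ := E.le_opNorm z
    change P z = 0 ↔ _
    rw [hP]
    constructor
    · intro h
      have h1 : inner ℂ z (((m : ℂ) ^ 2) • z - E.adjoint (E z)) = 0 := by rw [h, inner_zero_right]
      rw [inner_sub_right, inner_smul_right, ContinuousLinearMap.adjoint_inner_right,
        inner_self_eq_norm_sq_to_K, inner_self_eq_norm_sq_to_K] at h1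
      have h2 : m ^ 2 * ‖z‖ ^ 2 - ‖E z‖ ^ 2 = 0 := by
        apply Complex.ofReal_injective
        push_cast
        simpa using h1
      rw [← sq_eq_sq₀ (norm_nonneg _) (by positivity)]
      linarith
    · intro h
      have h1 : ‖E.adjoint (E z)‖ ≤ m * ‖E z‖ := by
        have := E.adjoint.le_opNorm (E z)
        rwa [LinearIsometryEquiv.norm_map] at this
      have h2 : ‖((m : ℂ) ^ 2) • z - E.adjoint (E z)‖ ^ 2 = ‖((m : ℂ) ^ 2) • z‖ ^ 2
          - 2 * (m ^ 2 * ‖E z‖ ^ 2) + ‖E.adjoint (E z)‖ ^ 2 := by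
        rw [norm_sub_sq (𝕜 := ℂ), inner_smul_left, ContinuousLinearMap.adjoint_inner_right,
          inner_self_eq_norm_sq_to_K]
        congr 3
        rw [map_pow, Complex.conj_ofReal]
        simp only [Complex.coe_algebraMap]
        norm_cast
      have h3 : ‖((m : ℂ) ^ 2) • z‖ = m ^ 2 * ‖z‖ := by
        rw [norm_smul, norm_pow, Complex.norm_real, Real.norm_of_nonneg hm0]
      rw [h3] at h2
      have h4 : ‖E.adjoint (E z)‖ ^ 2 ≤ (m * ‖E z‖) ^ 2 := by gcongr
      rw [h] at h2 h4
      have h5 : ‖((m : ℂ) ^ 2) • z - E.adjoint (E z)‖ ^ 2 ≤ 0 := by nlinarith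
      have h6 : ‖((m : ℂ) ^ 2) • z - E.adjoint (E z)‖ = 0 := by
        apply pow_eq_zero_iff (two_ne_zero) |>.1
        exact le_antisymm h5 (sq_nonneg _)
      exact norm_eq_zero.1 h6
  let X : V →L[ℂ] V := S.adjoint ∘L E
  have hX : ∀ z, inner ℂ z (X z) = inner ℂ (S z) (E z) := by
    intro z
    simp [X, ContinuousLinearMap.adjoint_inner_right]
  have hconv := th_convex (X : V →ₗ[ℂ] V) Z
  set W := (fun z : V => (inner ℂ z ((X : V →ₗ[ℂ] V) z) : ℂ)) '' {z | z ∈ Z ∧ ‖z‖ = 1} with hW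
  have hWc : IsCompact W := by
    apply IsCompact.image
    · have h1 : {z : V | z ∈ Z ∧ ‖z‖ = 1} = Metric.sphere 0 1 ∩ (Z : Set V) := by
        ext z; simp [and_comm]
      rw [h1]
      exact (isCompact_sphere (0 : V) 1).inter_right Z.closed_of_finiteDimensional
    · change Continuous fun z : V => (inner ℂ z (X z) : ℂ)
      fun_prop
  have h0W : (0 : ℂ) ∉ W := by
    rintro ⟨z, ⟨hz, hz1⟩, h0⟩
    have h1 := (hZ z).1 hz
    rw [hz1, mul_one] at h1
    refine hcon' z hz1 h1 ?_
    rw [← hX]; exact h0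
  obtain ⟨g, u, hg0, hgW⟩ := geometric_hahn_banach_point_closed hconv hWc.isClosed h0W
  rw [map_zero] at hg0
  set e : ℂ := ⟨g 1, g Complex.I⟩ with he
  have hge : ∀ x : ℂ, g x = (starRingEnd ℂ e * x).re := by
    intro x
    have : x = x.re • (1 : ℂ) + x.im • Complex.I := by
      simp [Complex.re_add_im]
    conv_lhs => rw [this]
    rw [map_add, map_smul, map_smul]
    simp [he]
    ring
  have hδ : ∀ n : ℕ, ∃ z : V, ‖z‖ = 1 ∧ ‖(E - (((1 / ((n : ℝ) + 1) : ℝ) : ℂ) * e) • S) z‖ =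
      ‖E - (((1 / ((n : ℝ) + 1) : ℝ) : ℂ) * e) • S‖ := fun n => norm_attained _
  choose z hz1 hz using hδ
  have hge_m : ∀ n : ℕ, m ≤ ‖(E - (((1 / ((n : ℝ) + 1) : ℝ) : ℂ) * e) • S) (z n)‖ := by
    intro n
    rw [hz]
    have := hs (s + (((1 / ((n : ℝ) + 1) : ℝ) : ℂ) * e))
    rw [add_smul, ← sub_sub] at this
    exact this
  obtain ⟨x, hx, φ, hφ, hlim⟩ := (isCompact_sphere (0 : V) 1).tendsto_subseq
    (x := z) (fun n => by simp [hz1])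
  have hx1 : ‖x‖ = 1 := by simpa using hx
  have hδlim : Filter.Tendsto (fun n : ℕ => (1 / (((φ n : ℕ) : ℝ) + 1) : ℝ)) Filter.atTop (nhds 0) :=
    (tendsto_one_div_add_atTop_nhds_zero_nat (𝕜 := ℝ)).comp hφ.tendsto_atTop
  have hδClim : Filter.Tendsto (fun n : ℕ => (((1 / (((φ n : ℕ) : ℝ) + 1) : ℝ) : ℂ) * e))
      Filter.atTop (nhds 0) := by
    have h1 := ((Complex.continuous_ofReal.tendsto 0).comp hδlim).mul_const e
    simpa using h1
  have hEx : m ≤ ‖E x‖ := by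
    have h1 : Filter.Tendsto (fun n => ‖E (z (φ n)) - (((1 / (((φ n : ℕ) : ℝ) + 1) : ℝ) : ℂ) * e) • S (z (φ n))‖)
        Filter.atTop (nhds ‖E x - (0 : ℂ) • S x‖) :=
      (((E.continuous.tendsto x).comp hlim).sub
        (hδClim.smul ((S.continuous.tendsto x).comp hlim))).norm
    rw [zero_smul, sub_zero] at h1
    refine ge_of_tendsto' h1 fun n => ?_
    have := hge_m (φ n)
    simpa using this
  have hxZ : x ∈ Z := by
    rw [hZ]
    refine le_antisymm (E.le_opNorm x) ?_
    rw [hx1, mul_one]; exact hEx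
  have hgx : u < g (inner ℂ (S x) (E x)) := by
    refine hgW _ ⟨x, ⟨hxZ, hx1⟩, ?_⟩
    exact hX x
  have hgle : g (inner ℂ (S x) (E x)) ≤ 0 := by
    have h1 : Filter.Tendsto (fun n => g (inner ℂ (S (z (φ n))) (E (z (φ n))))) Filter.atTop
        (nhds (g (inner ℂ (S x) (E x)))) := by
      have hc : Continuous fun y : V => g (inner ℂ (S y) (E y)) := by fun_prop
      exact (hc.tendsto x).comp hlim
    have h2 : Filter.Tendsto (fun n : ℕ => (1 / (((φ n : ℕ) : ℝ) + 1) : ℝ) * ((‖e‖ * ‖S‖) ^ 2 / 2))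
        Filter.atTop (nhds 0) := by
      simpa using hδlim.mul_const ((‖e‖ * ‖S‖) ^ 2 / 2)
    refine le_of_tendsto_of_tendsto' h1 h2 fun n => ?_
    set δ : ℝ := 1 / (((φ n : ℕ) : ℝ) + 1) with hδ
    have hδp : 0 < δ := by positivity
    set y := z (φ n) with hy
    have hy1 : ‖y‖ = 1 := hz1 _
    have h3 : m ≤ ‖E y - ((δ : ℂ) * e) • S y‖ := hge_m (φ n)
    have h4 : ‖E y‖ ≤ m := by simpa [hy1] using E.le_opNorm y
    have h5 : ‖S y‖ ≤ ‖S‖ := by simpa [hy1] using S.le_opNorm y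
    have h6 : ‖E y - ((δ : ℂ) * e) • S y‖ ^ 2 =
        ‖E y‖ ^ 2 - 2 * (δ * g (inner ℂ (S y) (E y))) + (δ * ‖e‖ * ‖S y‖) ^ 2 := by
      rw [norm_sub_sq (𝕜 := ℂ), ← inner_re_symm, inner_smul_left, hge, norm_smul, norm_mul,
        Complex.norm_real, Real.norm_of_nonneg hδp.le, map_mul (starRingEnd ℂ), Complex.conj_ofReal, mul_assoc (δ : ℂ)]
      congr 3
      exact Complex.re_ofReal_mul _ _
    have hm0 : 0 ≤ m := norm_nonneg _
    have h7 : m ^ 2 ≤ ‖E y - ((δ : ℂ) * e) • S y‖ ^ 2 := by gcongr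
    have h8 : ‖E y‖ ^ 2 ≤ m ^ 2 := by gcongr
    have h9 : (δ * ‖e‖ * ‖S y‖) ^ 2 ≤ (δ * ‖e‖ * ‖S‖) ^ 2 := by gcongr
    have h10 : δ * (2 * g (inner ℂ (S y) (E y))) ≤ δ * (δ * (‖e‖ * ‖S‖) ^ 2) := by nlinarith
    have h11 := le_of_mul_le_mul_left h10 hδp
    linarith
  linarith

theorem minimax {H : Type*} [NormedAddCommGroup H] [InnerProductSpace ℂ H] [CompleteSpace H]
    (S : H →L[ℂ] H) (hS : Function.Injective S) (M : ℝ) (hM : 0 ≤ M)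
    (h : ∀ y : H, ‖y‖ ^ 2 * ‖S y‖ ^ 2 - ‖(inner ℂ (S y) y : ℂ)‖ ^ 2 ≤ M ^ 2 * (‖y‖ ^ 2 * ‖S y‖ ^ 2)) :
    ∃ s : ℂ, ∀ y : H, ‖y - s • S y‖ ≤ M * ‖y‖ := by
  have hS0 : ∀ y, y ≠ 0 → S y ≠ 0 := fun y hy h0 => hy (hS (by rw [h0, map_zero]))
  have hfin : ∀ L : Submodule ℂ H, FiniteDimensional ℂ L →
      ∃ s : ℂ, ∀ y ∈ L, ‖y - s • S y‖ ≤ M * ‖y‖ := by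
    intro L hL
    by_cases hbot : L = ⊥
    · subst hbot
      refine ⟨0, fun y hy => ?_⟩
      rw [(Submodule.mem_bot ℂ).1 hy]; simp
    haveI : Nontrivial L := (Submodule.nontrivial_iff_ne_bot).2 hbot
    obtain ⟨v, hv⟩ := exists_ne (0 : L)
    obtain ⟨s, z, hz1, hzn, hz0⟩ := minimax_fin L.subtypeL (S ∘L L.subtypeL) (by
      intro h0
      have := congrArg (fun T : L →L[ℂ] H => T v) h0
      exact hS0 v (by simpa using hv) (by simpa using this))
    set m := ‖L.subtypeL - s • (S ∘L L.subtypeL)‖ with hm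
    have hz1' : ‖(z : H)‖ = 1 := hz1
    have hzz : ((z : H)) ≠ 0 := by
      intro h0; rw [h0, norm_zero] at hz1'; exact zero_ne_one hz1'
    simp only [sub_apply, smul_apply, ContinuousLinearMap.comp_apply, Submodule.subtypeL_apply] at hzn hz0
    have hSz : 0 < ‖S (z : H)‖ := norm_pos_iff.2 (hS0 _ hzz)
    have e0 : (z : H) = ((z : H) - s • S z) + s • S z := by abel
    have e1 : ‖(z : H)‖ ^ 2 = m ^ 2 + (‖s‖ * ‖S z‖) ^ 2 := by
      conv_lhs => rw [e0]
      rw [norm_add_sq (𝕜 := ℂ), hzn, inner_smul_right, inner_eq_zero_symm.1 hz0, norm_smul]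
      simp
    have e2 : ‖(inner ℂ (S (z : H)) (z : H) : ℂ)‖ = ‖s‖ * ‖S z‖ ^ 2 := by
      have : inner ℂ (S (z : H)) (z : H) = s * (‖S z‖ : ℂ) ^ 2 := by
        have e0' : inner ℂ (S (z : H)) (z : H)
            = inner ℂ (S (z : H)) (((z : H) - s • S z) + s • S z) :=
          congrArg (fun y => (inner ℂ (S (z : H)) y : ℂ)) e0
        rw [e0', inner_add_right, inner_smul_right, hz0, inner_self_eq_norm_sq_to_K]
        simp
      rw [this]; simp
    have e3 := h (z : H)
    rw [e2, hz1'] at e3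
    rw [hz1'] at e1
    have e4 : m ^ 2 * ‖S z‖ ^ 2 ≤ M ^ 2 * ‖S z‖ ^ 2 := by nlinarith
    have e5 : m ^ 2 ≤ M ^ 2 := le_of_mul_le_mul_right e4 (by positivity)
    have e6 : m ≤ M := le_of_sq_le_sq e5 hM
    refine ⟨s, fun y hy => ?_⟩
    have := (L.subtypeL - s • (S ∘L L.subtypeL)).le_opNorm ⟨y, hy⟩
    calc ‖y - s • S y‖ ≤ m * ‖y‖ := by simpa using this
      _ ≤ M * ‖y‖ := by gcongr
  by_cases htriv : ∃ y0 : H, y0 ≠ 0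
  · obtain ⟨y0, hy0⟩ := htriv
    let D : H → Set ℂ := fun y => {s | ‖y - s • S y‖ ≤ M * ‖y‖}
    have hDc : ∀ y, IsClosed (D y) := fun y =>
      isClosed_le (by fun_prop) continuous_const
    have hSy : 0 < ‖S y0‖ := norm_pos_iff.2 (hS0 _ hy0)
    have hK : IsCompact (D y0) := by
      refine (isCompact_closedBall (0 : ℂ) ((1 + M) * ‖y0‖ / ‖S y0‖)).of_isClosed_subset (hDc y0) ?_
      intro s hs
      have hs' : ‖y0 - s • S y0‖ ≤ M * ‖y0‖ := hs
      rw [mem_closedBall_zero_iff, le_div_iff₀ hSy, ← norm_smul]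
      have h1 := norm_sub_norm_le (s • S y0) y0
      rw [norm_sub_rev] at h1
      linarith
    obtain ⟨s, -, hs⟩ := hK.inter_iInter_nonempty D hDc (by
      intro u
      classical
      obtain ⟨s, hs⟩ := hfin (Submodule.span ℂ ((insert y0 u : Finset H) : Set H))
        (FiniteDimensional.span_finset ℂ _)
      refine ⟨s, hs y0 (Submodule.subset_span (by simp)), ?_⟩
      simp only [Set.mem_iInter]
      intro y hy
      exact hs y (Submodule.subset_span (by simp [hy])))
    refine ⟨s, fun y => ?_⟩
    exact Set.mem_iInter.1 hs y
  · push Not at htriv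
    refine ⟨0, fun y => ?_⟩
    rw [htriv y]; simp
theorem lin_area {H : Type*} [NormedAddCommGroup H] [InnerProductSpace ℂ H]
    (B : H →L[ℂ] H) (M : ℝ) (hM : 0 ≤ M) (z : H)
    (hz : gmresRes B z 1 ≤ M * gmresRes B z 0) :
    ‖z‖ ^ 2 * ‖B z‖ ^ 2 - ‖(inner ℂ z (B z) : ℂ)‖ ^ 2 ≤ M ^ 2 * (‖z‖ ^ 2 * ‖B z‖ ^ 2) := by
  by_cases hv : B z = 0
  · simp [hv]
  set v := B z with hvdef
  have ha := area_aux z v hv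
  set e := z - (inner ℂ v z / (‖v‖ : ℂ) ^ 2) • v with he
  have hvn : (‖v‖ : ℂ) ≠ 0 := by simpa using hv
  have horth : inner ℂ v e = 0 := by
    rw [he, inner_sub_right, inner_smul_right, inner_self_eq_norm_sq_to_K]
    simp only [Complex.coe_algebraMap]
    field_simp
    ring
  have h1 : ‖e‖ ≤ gmresRes B z 1 := by
    apply le_csInf
    · exact ⟨_, 1, by simp, by simp, rfl⟩
    · rintro x ⟨p, hp, hp0, rfl⟩
      obtain ⟨b, c, rfl⟩ := Polynomial.exists_eq_X_add_C_of_natDegree_le_one hp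
      have hc : c = 1 := by simpa using hp0
      subst hc
      have h2 : (Polynomial.aeval B (Polynomial.C b * Polynomial.X + Polynomial.C 1)) z
          = e + (b + inner ℂ v z / (‖v‖ : ℂ) ^ 2) • v := by
        have : (Polynomial.aeval B (Polynomial.C b * Polynomial.X + Polynomial.C 1)) z
            = b • v + z := by
          simp [Algebra.algebraMap_eq_smul_one, hvdef]
        rw [this, he, add_smul]; abel
      rw [h2]
      have h3 := norm_add_sq (𝕜 := ℂ) e ((b + inner ℂ v z / (‖v‖ : ℂ) ^ 2) • v)
      rw [inner_smul_right, inner_eq_zero_symm.1 horth, mul_zero, map_zero] at h3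
      refine le_of_sq_le_sq ?_ (norm_nonneg _)
      rw [h3]
      nlinarith [sq_nonneg ‖((b + inner ℂ v z / (‖v‖ : ℂ) ^ 2) • v)‖]
  have h2 : gmresRes B z 0 ≤ ‖z‖ := by
    have := gmres_le_of_poly B z 0 1 (by simp) (by simp)
    simpa using this
  have h3 : ‖e‖ ≤ M * ‖z‖ := h1.trans (hz.trans (by gcongr))
  rw [← ha]
  have h4 : ‖e‖ ^ 2 ≤ (M * ‖z‖) ^ 2 := by gcongr
  calc ‖e‖ ^ 2 * ‖v‖ ^ 2 ≤ (M * ‖z‖) ^ 2 * ‖v‖ ^ 2 := by gcongr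
    _ = _ := by ring

theorem approxNum_nonneg' {H : Type*} [NormedAddCommGroup H] [InnerProductSpace ℂ H]
    (T : H →L[ℂ] H) (j : ℕ) : 0 ≤ approxNum T j := by
  apply Real.sInf_nonneg
  rintro x ⟨F, -, rfl⟩
  exact norm_nonneg _

theorem approx_step {H : Type*} [NormedAddCommGroup H] [InnerProductSpace ℂ H]
    (B A : H ≃L[ℂ] H) (C : H →L[ℂ] H)
    (hA : (A : H →L[ℂ] H) = (B : H →L[ℂ] H) + C)
    (M : ℝ) (hM0 : 0 ≤ M) (s : ℂ) (hs : ∀ y : H, ‖y - s • B.symm y‖ ≤ M * ‖y‖)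
    (j : ℕ) (ε : ℝ) (hε : 0 < ε) :
    ∃ F : H →L[ℂ] H, LinearMap.rank (F : H →ₗ[ℂ] H) < ((j + 1 : ℕ) : Cardinal) ∧
      ‖(ContinuousLinearMap.id ℂ H - s • (A.symm : H →L[ℂ] H)) - F‖ ≤
        M + (1 + M) * ‖(A.symm : H →L[ℂ] H)‖ * (approxNum C (j + 1) + ε) := by
  obtain ⟨x, ⟨F, hF, rfl⟩, hx⟩ := exists_lt_of_csInf_lt
    (s := {x : ℝ | ∃ F : H →L[ℂ] H,
      LinearMap.rank (F : H →ₗ[ℂ] H) < ((j + 1 : ℕ) : Cardinal) ∧ x = ‖C - F‖})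
    ⟨_, 0, by
      have h0 : LinearMap.rank (((0 : H →L[ℂ] H)) : H →ₗ[ℂ] H) = 0 := by
        rw [ContinuousLinearMap.toLinearMap_zero, LinearMap.rank_zero]
      rw [h0]; exact_mod_cast Nat.succ_pos j, rfl⟩
    (show _ < approxNum C (j + 1) + ε from lt_add_of_pos_right _ hε)
  have hb : ∀ y : H, ‖s • B.symm y‖ ≤ (1 + M) * ‖y‖ := by
    intro y
    have h1 := norm_sub_norm_le (s • B.symm y) y
    rw [norm_sub_rev] at h1
    linarith [hs y]
  refine ⟨(s • (B.symm : H →L[ℂ] H)) ∘L (F ∘L (A.symm : H →L[ℂ] H)), ?_, ?_⟩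
  · refine lt_of_le_of_lt ?_ hF
    refine le_trans (LinearMap.rank_comp_le_right ((F ∘L (A.symm : H →L[ℂ] H) : H →L[ℂ] H) : H →ₗ[ℂ] H) ((s • (B.symm : H →L[ℂ] H) : H →L[ℂ] H) : H →ₗ[ℂ] H)) ?_
    exact LinearMap.rank_comp_le_left ((A.symm : H →L[ℂ] H) : H →ₗ[ℂ] H) (F : H →ₗ[ℂ] H)
  · refine ContinuousLinearMap.opNorm_le_bound _ (by
      have := approxNum_nonneg' C (j + 1)
      positivity) fun y => ?_
    set u := A.symm y with hu
    have hy : y = B u + C u := by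
      have h1 : A u = y := A.apply_symm_apply y
      rw [← h1]
      exact congrArg (fun T : H →L[ℂ] H => T u) hA
    have hBy : B.symm y = u + B.symm (C u) := by
      rw [hy, map_add, B.symm_apply_apply]
    have hval : ((ContinuousLinearMap.id ℂ H - s • (A.symm : H →L[ℂ] H)) -
        (s • (B.symm : H →L[ℂ] H)) ∘L (F ∘L (A.symm : H →L[ℂ] H))) y =
        (y - s • B.symm y) + s • B.symm ((C - F) u) := by
      have : ((ContinuousLinearMap.id ℂ H - s • (A.symm : H →L[ℂ] H)) -
        (s • (B.symm : H →L[ℂ] H)) ∘L (F ∘L (A.symm : H →L[ℂ] H))) y =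
        y - s • u - s • B.symm (F u) := rfl
      rw [this, hBy, sub_apply, map_sub, smul_sub, smul_add]
      abel
    rw [hval]
    have hu' : ‖u‖ ≤ ‖(A.symm : H →L[ℂ] H)‖ * ‖y‖ := (A.symm : H →L[ℂ] H).le_opNorm y
    calc ‖(y - s • B.symm y) + s • B.symm ((C - F) u)‖
        ≤ ‖y - s • B.symm y‖ + ‖s • B.symm ((C - F) u)‖ := norm_add_le _ _
      _ ≤ M * ‖y‖ + (1 + M) * ((approxNum C (j + 1) + ε) *
            (‖(A.symm : H →L[ℂ] H)‖ * ‖y‖)) := by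
          refine add_le_add (hs y) ((hb _).trans ?_)
          have h1 := (C - F).le_opNorm u
          have h2 : ‖C - F‖ * ‖u‖ ≤ (approxNum C (j + 1) + ε) *
            (‖(A.symm : H →L[ℂ] H)‖ * ‖y‖) := by
            exact mul_le_mul hx.le hu' (norm_nonneg _) ((norm_nonneg _).trans hx.le)
          have := h1.trans h2
          gcongr
      _ = _ := by ring

/-- Theorem 1.1 (bound (1.2)): stability of linear GMRES convergence under
compact perturbation. -/
theorem gmres_compact_perturbation_bound
    {H : Type*} [NormedAddCommGroup H] [InnerProductSpace ℂ H]
    [CompleteSpace H] [TopologicalSpace.SeparableSpace H]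
    (B A : H ≃L[ℂ] H) (C : H →L[ℂ] H)
    (hC : IsCompactOperator (⇑C))
    (hA : (A : H →L[ℂ] H) = (B : H →L[ℂ] H) + C)
    (M : ℝ) (hM0 : 0 ≤ M) (hM1 : M ≤ 1)
    (hlin : ∀ (z : H) (k : ℕ),
      gmresRes (B : H →L[ℂ] H) z (k + 1) ≤ M * gmresRes (B : H →L[ℂ] H) z k)
    (r0 : H) (k : ℕ) (hk : 1 ≤ k) :
    gmresRes (A : H →L[ℂ] H) r0 k ≤
      (∏ j ∈ Finset.range k,
        (M + (1 + M) * ‖(A.symm : H →L[ℂ] H)‖ * approxNum C (j + 1))) * ‖r0‖ := by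
  by_cases hp : ∀ p : Polynomial ℂ, p.natDegree ≤ k → p.eval 0 = 1 →
      (Polynomial.aeval (A : H →L[ℂ] H) p) r0 ≠ 0
  swap
  · push Not at hp
    obtain ⟨p, hp1, hp2, hp3⟩ := hp
    have h1 := gmres_le_of_poly (A : H →L[ℂ] H) r0 k p hp1 hp2
    rw [hp3, norm_zero] at h1
    refine h1.trans (mul_nonneg (Finset.prod_nonneg fun j _ => ?_) (norm_nonneg _))
    have := approxNum_nonneg' C (j + 1)
    positivity
  obtain ⟨s, hs⟩ := minimax (B.symm : H →L[ℂ] H) B.symm.injective M hM0 (by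
    intro y
    have h1 := lin_area (B : H →L[ℂ] H) M hM0 (B.symm y) (hlin _ 0)
    have h2 : (B : H →L[ℂ] H) (B.symm y) = y := B.apply_symm_apply y
    rw [h2] at h1
    change ‖y‖ ^ 2 * ‖B.symm y‖ ^ 2 - ‖(inner ℂ (B.symm y) y : ℂ)‖ ^ 2
      ≤ M ^ 2 * (‖y‖ ^ 2 * ‖B.symm y‖ ^ 2)
    linarith)
  obtain ⟨w, q, hw, hq, hwq, hAq, hres⟩ := krylov A r0 k hp
  refine hres.trans ?_
  refine mul_le_mul_of_nonneg_right ?_ (norm_nonneg _)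
  have key : ∀ ε : ℝ, 0 < ε → ∏ j, ‖(inner ℂ (q j) (w j) : ℂ)‖ ≤ ∏ j ∈ Finset.range k,
      (M + (1 + M) * ‖(A.symm : H →L[ℂ] H)‖ * (approxNum C (j + 1) + ε)) := by
    intro ε hε
    have hG : ∀ i j, inner ℂ (q i) ((ContinuousLinearMap.id ℂ H - s • (A.symm : H →L[ℂ] H)) (w j))
        = inner ℂ (q i) (w j) - s * inner ℂ (q i) (A.symm (w j)) := by
      intro i j
      rw [← inner_smul_right, ← inner_sub_right]
      rfl
    have h1 := tri_bound w q hw hq (ContinuousLinearMap.id ℂ H - s • (A.symm : H →L[ℂ] H))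
      (by
        intro i j hij
        rw [hG, hwq i j hij, hAq i j hij.le, mul_zero, sub_zero])
      (fun j => M + (1 + M) * ‖(A.symm : H →L[ℂ] H)‖ * (approxNum C ((j : ℕ) + 1) + ε))
      (fun j => approx_step B A C hA M hM0 s hs j ε hε)
    rw [Fin.prod_univ_eq_prod_range
      (fun j => M + (1 + M) * ‖(A.symm : H →L[ℂ] H)‖ * (approxNum C (j + 1) + ε))] at h1
    refine le_trans (le_of_eq ?_) h1
    refine Finset.prod_congr rfl fun j _ => ?_
    rw [hG, hAq j j le_rfl, mul_zero, sub_zero]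
  have hcont : Continuous fun ε : ℝ => ∏ j ∈ Finset.range k,
      (M + (1 + M) * ‖(A.symm : H →L[ℂ] H)‖ * (approxNum C (j + 1) + ε)) := by fun_prop
  have hlim := (hcont.tendsto 0).mono_left (nhdsWithin_le_nhds (s := Set.Ioi (0 : ℝ)))
  simp only [add_zero] at hlim
  refine ge_of_tendsto hlim ?_
  filter_upwards [self_mem_nhdsWithin] with ε hε
  exact key ε hε
end

section
/- Let H be a complex separable Hilbert space, let B be an invertible bounded linear operator on H, let C be a compact linear operator on H, and suppose A = B + C is invertible (bijective with bounded inverse). Let M ∈ [0,1] be such that ‖r_k^{B,z}‖ ≤ M·‖r_{k-1}^{B,z}‖ for every z ∈ H and every k ≥ 1. Then for every r0 ∈ H, limsup_{k→∞} ‖r_k^{A,r0}‖ / ‖r_{k-1}^{A,r0}‖ ≤ M, where a quotient with zero denominator is interpreted as 0. -/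
open Polynomial Filter Topology

namespace GmresAux

variable {H : Type*} [NormedAddCommGroup H] [InnerProductSpace ℂ H]

/-- The linear map `p ↦ p(T) r0`. -/
noncomputable def kry (T : H →L[ℂ] H) (r0 : H) : ℂ[X] →ₗ[ℂ] H where
  toFun p := aeval T p r0
  map_add' p q := by simp
  map_smul' c p := by simp

lemma kry_X_mul (T : H →L[ℂ] H) (r0 : H) (p : ℂ[X]) :
    kry T r0 (X * p) = T (kry T r0 p) := by
  simp [kry]

lemma res_le (T : H →L[ℂ] H) (r0 : H) (k : ℕ) (p : ℂ[X]) (hp : p.natDegree ≤ k)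
    (h0 : p.eval 0 = 1) : gmresRes T r0 k ≤ ‖kry T r0 p‖ := by
  apply csInf_le
  · refine ⟨0, ?_⟩
    rintro x ⟨p, -, -, rfl⟩
    positivity
  · exact ⟨p, hp, h0, rfl⟩

lemma exists_min (T : H →L[ℂ] H) (r0 : H) (k : ℕ) :
    ∃ p : ℂ[X], p.natDegree ≤ k ∧ p.eval 0 = 1 ∧ gmresRes T r0 k = ‖kry T r0 p‖ ∧
      ∀ q : ℂ[X], q.natDegree ≤ k → q.eval 0 = 0 →
        inner ℂ (kry T r0 q) (kry T r0 p) = 0 := by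
  let D : Submodule ℂ ℂ[X] := degreeLT ℂ (k + 1) ⊓ LinearMap.ker (leval (0 : ℂ))
  have hD : ∀ q : ℂ[X], q ∈ D ↔ q.natDegree ≤ k ∧ q.eval 0 = 0 := by
    intro q
    simp only [D, Submodule.mem_inf, LinearMap.mem_ker, leval_apply, mem_degreeLT]
    rw [natDegree_le_iff_degree_le, degree_lt_iff_coeff_zero,
      degree_le_iff_coeff_zero]
    simp
  have : FiniteDimensional ℂ (degreeLT ℂ (k + 1)) :=
    (degreeLTEquiv ℂ (k + 1)).symm.finiteDimensional
  have : FiniteDimensional ℂ D := Submodule.finiteDimensional_inf_left _ _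
  let W : Submodule ℂ H := D.map (kry T r0)
  have : FiniteDimensional ℂ W := inferInstance
  obtain ⟨q, hq, hqe⟩ := (W.orthogonalProjectionOnto r0).2
  have hqe' : kry T r0 q = W.orthogonalProjectionOnto r0 := hqe
  have hq' := (hD q).1 hq
  have h1 : kry T r0 1 = r0 := by simp [kry]
  have horth : ∀ q' : ℂ[X], q'.natDegree ≤ k → q'.eval 0 = 0 →
        inner ℂ (kry T r0 q') (kry T r0 (1 - q)) = 0 := by
    intro q' h h'
    rw [map_sub, h1, hqe']
    exact Submodule.sub_starProjection_mem_orthogonal r0 _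
      (Submodule.mem_map_of_mem ((hD q').2 ⟨h, h'⟩))
  have hdeg : (1 - q).natDegree ≤ k :=
    (natDegree_sub_le _ _).trans (by simpa using hq'.1)
  have hev : (1 - q).eval 0 = 1 := by simp [hq'.2]
  refine ⟨1 - q, hdeg, hev, ?_, horth⟩
  apply le_antisymm (res_le T r0 k _ hdeg hev)
  apply le_csInf
  · exact ⟨_, 1 - q, hdeg, hev, rfl⟩
  · rintro x ⟨p, hp, hp0, rfl⟩
    change _ ≤ ‖kry T r0 p‖
    have ho := horth (p - (1 - q)) ((natDegree_sub_le _ _).trans (by simp [hp, hdeg]))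
      (by rw [eval_sub, hp0, hev, sub_self])
    have hs : kry T r0 p = kry T r0 (p - (1 - q)) + kry T r0 (1 - q) := by
      rw [← map_add]; congr 1; ring
    have := norm_add_sq_eq_norm_sq_add_norm_sq_of_inner_eq_zero _ _ ho
    rw [← hs] at this
    nlinarith [norm_nonneg (kry T r0 p), norm_nonneg (kry T r0 (1-q)),
      mul_self_nonneg ‖kry T r0 (p - (1 - q))‖]

lemma step (B A : H ≃L[ℂ] H) (C : H →L[ℂ] H)
    (hA : (A : H →L[ℂ] H) = (B : H →L[ℂ] H) + C)
    (M : ℝ) (hM1 : M ≤ 1)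
    (hlin : ∀ (z : H) (k : ℕ),
      gmresRes (B : H →L[ℂ] H) z (k + 1) ≤ M * gmresRes (B : H →L[ℂ] H) z k)
    (hM0 : 0 ≤ M) (z : H) :
    ∃ α : ℂ, ‖z - α • A z‖ ≤ M * ‖z‖ + 2 * ‖(B.symm : H →L[ℂ] H)‖ * ‖C z‖ := by
  obtain ⟨p, hp, hp0, hpe, -⟩ := exists_min (B : H →L[ℂ] H) z 1
  obtain ⟨a, b, rfl⟩ := exists_eq_X_add_C_of_natDegree_le_one hp
  have hb : b = 1 := by simpa using hp0
  subst hb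
  have h1 : kry (B : H →L[ℂ] H) z (Polynomial.C a * X + Polynomial.C 1) = z - (-a) • B z := by
    simp [kry, Algebra.algebraMap_eq_smul_one, add_comm]
  have h2 : gmresRes (B : H →L[ℂ] H) z 0 ≤ ‖z‖ := by
    simpa [kry] using res_le (B : H →L[ℂ] H) z 0 1 (by simp) (by simp)
  have h3 : ‖z - (-a) • B z‖ ≤ M * ‖z‖ := by
    rw [← h1, ← hpe]
    exact (hlin z 0).trans (mul_le_mul_of_nonneg_left h2 hM0)
  generalize -a = α at h3
  refine ⟨α, ?_⟩
  have hAz : A z = B z + C z := by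
    have := congrArg (fun f : H →L[ℂ] H => f z) hA
    simpa using this
  by_cases hz : z = 0
  · subst hz; simp
  have hzp : 0 < ‖z‖ := norm_pos_iff.2 hz
  have h4 : ‖z‖ ≤ ‖(B.symm : H →L[ℂ] H)‖ * ‖B z‖ := by
    simpa using (B.symm : H →L[ℂ] H).le_opNorm (B z)
  have h5 : ‖α‖ * ‖B z‖ ≤ 2 * ‖z‖ := by
    rw [← norm_smul]
    have : ‖α • B z‖ ≤ ‖z‖ + ‖z - α • B z‖ := by
      simpa using norm_sub_le z (z - α • B z)
    nlinarith
  have h6 : ‖α‖ ≤ 2 * ‖(B.symm : H →L[ℂ] H)‖ := by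
    have : ‖α‖ * ‖z‖ ≤ (2 * ‖(B.symm : H →L[ℂ] H)‖) * ‖z‖ := by
      calc ‖α‖ * ‖z‖ ≤ ‖α‖ * (‖(B.symm : H →L[ℂ] H)‖ * ‖B z‖) := by gcongr
        _ = ‖(B.symm : H →L[ℂ] H)‖ * (‖α‖ * ‖B z‖) := by ring
        _ ≤ ‖(B.symm : H →L[ℂ] H)‖ * (2 * ‖z‖) := by gcongr
        _ = _ := by ring
    exact le_of_mul_le_mul_right this hzp
  calc ‖z - α • A z‖ = ‖(z - α • B z) - α • C z‖ := by rw [hAz, smul_add]; congr 1; abel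
    _ ≤ ‖z - α • B z‖ + ‖α • C z‖ := norm_sub_le _ _
    _ ≤ _ := by rw [norm_smul]; gcongr

lemma compact_weak [CompleteSpace H] (C : H →L[ℂ] H) (hC : IsCompactOperator (⇑C)) (u : ℕ → H)
    (hu : ∀ n, ‖u n‖ ≤ 1) (hw : ∀ w, Tendsto (fun n => inner ℂ w (u n)) atTop (𝓝 0)) :
    Tendsto (fun n => ‖C (u n)‖) atTop (𝓝 0) := by
  have : Tendsto (fun n => C (u n)) atTop (𝓝 0) := by
    apply tendsto_of_subseq_tendsto
    intro ns hns
    obtain ⟨S, hS, hSs⟩ := hC.image_closedBall_subset_compact 1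
    obtain ⟨y, -, φ, hφ, hy⟩ := hS.tendsto_subseq (x := fun n => C (u (ns n)))
      (fun n => hSs ⟨u (ns n), by simpa using hu _, rfl⟩)
    refine ⟨φ, ?_⟩
    have h1 : Tendsto (fun n => inner ℂ y (C (u (ns (φ n))))) atTop (𝓝 (inner ℂ y y)) :=
      tendsto_const_nhds.inner hy
    have h2 := (hw (C.adjoint y)).comp (hns.comp hφ.tendsto_atTop)
    have h3 : inner ℂ y y = 0 := by
      refine tendsto_nhds_unique h1 (h2.congr fun n => ?_)
      simp [ContinuousLinearMap.adjoint_inner_left]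
    rw [inner_self_eq_zero] at h3
    subst h3
    exact hy
  simpa using this.norm

/-- The decreasing chain `A^j K`. -/
noncomputable def chain (A : H ≃L[ℂ] H) (K : Submodule ℂ H) : ℕ → Submodule ℂ H
  | 0 => K
  | n + 1 => (chain A K n).map (A : H →ₗ[ℂ] H)

lemma chain_closed (A : H ≃L[ℂ] H) (K : Submodule ℂ H) (hK : IsClosed (K : Set H)) (n : ℕ) :
    IsClosed (chain A K n : Set H) := by
  induction n with
  | zero => exact hK
  | succ n ih =>
    simp only [chain, Submodule.map_coe]
    exact A.toHomeomorph.isClosedMap _ ih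

lemma chain_anti (A : H ≃L[ℂ] H) (K : Submodule ℂ H) (hK : ∀ x ∈ K, A x ∈ K) :
    Antitone (chain A K) := by
  apply antitone_nat_of_succ_le
  intro n
  induction n with
  | zero =>
    rintro _ ⟨x, hx, rfl⟩
    exact hK x hx
  | succ n ih => exact Submodule.map_mono ih

lemma chain_ne (A : H ≃L[ℂ] H) (K : Submodule ℂ H) (r : H) (hr : r ∈ K)
    (hr' : r ∉ K.map (A : H →ₗ[ℂ] H)) (n : ℕ) :
    ∃ x ∈ chain A K n, x ∉ chain A K (n + 1) := by
  induction n with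
  | zero => exact ⟨r, hr, hr'⟩
  | succ n ih =>
    obtain ⟨x, hx, hx'⟩ := ih
    refine ⟨A x, ⟨x, hx, rfl⟩, ?_⟩
    rintro ⟨y, hy, hyx⟩
    have : y = x := A.injective hyx
    exact hx' (this ▸ hy)

lemma le_map [CompleteSpace H] (B A : H ≃L[ℂ] H) (C : H →L[ℂ] H) (hC : IsCompactOperator (⇑C))
    (M : ℝ) (hM1 : M < 1) (c : ℝ)
    (hstep : ∀ z, ∃ α : ℂ, ‖z - α • A z‖ ≤ M * ‖z‖ + c * ‖C z‖)
    (K : Submodule ℂ H) (hKc : IsClosed (K : Set H)) (hK : ∀ x ∈ K, A x ∈ K) :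
    K ≤ K.map (A : H →ₗ[ℂ] H) := by
  intro r hr
  by_contra hr'
  have hex : ∀ n, ∃ v ∈ chain A K n, ‖v‖ = 1 ∧ ∀ w ∈ chain A K (n + 1), inner ℂ w v = 0 := by
    intro n
    obtain ⟨x, hx, hx'⟩ := chain_ne A K r hr hr' n
    have : CompleteSpace (chain A K (n + 1)) :=
      (chain_closed A K hKc (n + 1)).completeSpace_coe
    set y : H := x - (chain A K (n + 1)).orthogonalProjectionOnto x with hy
    have hy0 : y ≠ 0 := by
      intro h
      apply hx'
      rw [hy, sub_eq_zero] at h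
      rw [h]
      exact Subtype.prop _
    have hyn : y ∈ chain A K n :=
      Submodule.sub_mem _ hx (chain_anti A K hK (Nat.le_succ n) (Subtype.prop _))
    refine ⟨((‖y‖⁻¹ : ℝ) : ℂ) • y, Submodule.smul_mem _ _ hyn, ?_, ?_⟩
    · simp [norm_smul, hy0]
    · intro w hw
      have h0 : inner ℂ w y = 0 := Submodule.sub_starProjection_mem_orthogonal x w hw
      rw [inner_smul_right, h0, mul_zero]
  choose v hv hv1 hvo using hex
  have hlt : ∀ i j, i < j → inner ℂ (v j) (v i) = 0 := fun i j hij =>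
    hvo i _ (chain_anti A K hK hij (hv j))
  have hon : Orthonormal ℂ v := by
    refine ⟨hv1, fun i j hij => ?_⟩
    rcases lt_or_gt_of_ne hij with h | h
    · exact inner_eq_zero_symm.1 (hlt _ _ h)
    · exact hlt _ _ h
  have hweak : ∀ w, Tendsto (fun n => inner ℂ w (v n)) atTop (𝓝 0) := by
    intro w
    have h1 := (hon.inner_products_summable (x := w)).tendsto_atTop_zero
    have h2 := h1.sqrt
    rw [tendsto_zero_iff_norm_tendsto_zero]
    simpa [Real.sqrt_sq, norm_inner_symm] using h2
  have hlim := compact_weak C hC v (fun n => (hv1 n).le) hweak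
  have hle : ∀ n, 1 ≤ M + c * ‖C (v n)‖ := by
    intro n
    obtain ⟨α, hα⟩ := hstep (v n)
    rw [hv1, mul_one] at hα
    refine le_trans ?_ hα
    have ho : inner ℂ (v n) (-(α • A (v n))) = 0 := by
      rw [inner_neg_right, inner_smul_right,
        inner_eq_zero_symm.1 (hvo n (A (v n)) ⟨v n, hv n, rfl⟩)]
      simp
    have := norm_add_sq_eq_norm_sq_add_norm_sq_of_inner_eq_zero _ _ ho
    rw [hv1, ← sub_eq_add_neg] at this
    nlinarith [norm_nonneg (v n - α • A (v n)), mul_self_nonneg ‖-(α • A (v n))‖]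
  have := ge_of_tendsto' ((hlim.const_mul c).const_add M) hle
  simp at this
  linarith

end GmresAux

open GmresAux in
/-- Theorem 1.1 (bound (1.3)): the asymptotic GMRES convergence factor of a
compactly perturbed operator is at most the linear reduction factor of the
unperturbed operator. -/
theorem gmres_compact_perturbation_limsup
    {H : Type*} [NormedAddCommGroup H] [InnerProductSpace ℂ H]
    [CompleteSpace H] [TopologicalSpace.SeparableSpace H]
    (B A : H ≃L[ℂ] H) (C : H →L[ℂ] H)
    (hC : IsCompactOperator (⇑C))
    (hA : (A : H →L[ℂ] H) = (B : H →L[ℂ] H) + C)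
    (M : ℝ) (hM0 : 0 ≤ M) (hM1 : M ≤ 1)
    (hlin : ∀ (z : H) (k : ℕ),
      gmresRes (B : H →L[ℂ] H) z (k + 1) ≤ M * gmresRes (B : H →L[ℂ] H) z k)
    (r0 : H) :
    Filter.limsup
      (fun k : ℕ =>
        gmresRes (A : H →L[ℂ] H) r0 (k + 1) / gmresRes (A : H →L[ℂ] H) r0 k)
      Filter.atTop ≤ M := by
  have hstep := step B A C hA M hM1 hlin hM0
  set c : ℝ := 2 * ‖(B.symm : H →L[ℂ] H)‖ with hc
  choose p hp hp0 hpe hpo using exists_min (A : H →L[ℂ] H) r0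
  let L := kry (A : H →L[ℂ] H) r0
  have hnn : ∀ k, 0 ≤ gmresRes (A : H →L[ℂ] H) r0 k := fun k => by rw [hpe]; positivity
  have hnext : ∀ k (α : ℂ), gmresRes (A : H →L[ℂ] H) r0 (k + 1) ≤
      ‖L (p k) - α • A (L (p k))‖ := by
    intro k α
    have h := res_le (A : H →L[ℂ] H) r0 (k + 1) (p k - α • (X * p k)) ?_ ?_
    · rw [map_sub, map_smul, kry_X_mul] at h
      exact h
    · refine (natDegree_sub_le _ _).trans (max_le ((hp k).trans (Nat.le_succ k)) ?_)
      refine (natDegree_smul_le _ _).trans (natDegree_mul_le.trans ?_)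
      have := hp k
      simp; omega
    · simp [hp0]
  have hcob : IsCoboundedUnder (· ≤ ·) atTop (fun k : ℕ =>
        gmresRes (A : H →L[ℂ] H) r0 (k + 1) / gmresRes (A : H →L[ℂ] H) r0 k) :=
    IsCoboundedUnder.of_frequently_ge (a := 0)
      (Frequently.of_forall fun k => div_nonneg (hnn _) (hnn _))
  rcases hM1.eq_or_lt with rfl | hlt
  · refine limsup_le_of_le hcob (Eventually.of_forall fun k => ?_)
    refine div_le_one_of_le₀ ?_ (hnn k)
    have := hnext k 0
    rw [hpe k]
    simpa using this
  let S : Submodule ℂ H := LinearMap.range L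
  let K : Submodule ℂ H := S.topologicalClosure
  have hSA : ∀ x ∈ S, A x ∈ S := by
    rintro _ ⟨q, rfl⟩
    exact ⟨X * q, kry_X_mul _ _ _⟩
  have hKc : IsClosed (K : Set H) := S.isClosed_topologicalClosure
  have hKA : ∀ x ∈ K, A x ∈ K := fun x hx =>
    map_mem_closure A.continuous hx hSA
  have hKle := le_map B A C hC M hlt c hstep K hKc hKA
  let u : ℕ → H := fun k => ((‖L (p k)‖⁻¹ : ℝ) : ℂ) • L (p k)
  have hu1 : ∀ k, ‖u k‖ ≤ 1 := by
    intro k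
    simp only [u, norm_smul, Complex.norm_real, norm_inv, norm_norm]
    exact inv_mul_le_one
  have huK : ∀ k, u k ∈ K := fun k =>
    K.smul_mem _ (S.le_topologicalClosure ⟨p k, rfl⟩)
  have huo : ∀ k (q : ℂ[X]), q.natDegree + 1 ≤ k → inner ℂ (A (L q)) (u k) = 0 := by
    intro k q hq
    have h := hpo k (X * q) (natDegree_mul_le.trans (by simp; omega)) (by simp)
    rw [kry_X_mul] at h
    simp only [u, inner_smul_right]
    rw [mul_eq_zero]; right; exact h
  have hweak : ∀ w, Tendsto (fun n => inner ℂ w (u n)) atTop (𝓝 0) := by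
    intro w
    have : CompleteSpace K := hKc.completeSpace_coe
    obtain ⟨y, hy, hyw⟩ := hKle (K.orthogonalProjectionOnto w).2
    have hyw' : A y = K.orthogonalProjectionOnto w := hyw
    have hin : ∀ n, inner ℂ w (u n) = inner ℂ (A y) (u n) := by
      intro n
      have := inner_eq_zero_symm.1
        (Submodule.sub_starProjection_mem_orthogonal (K := K) w (u n) (huK n))
      rw [inner_sub_left, sub_eq_zero] at this
      rw [this, hyw']
      rfl
    rw [Metric.tendsto_atTop]
    intro ε hε
    have hcl : A y ∈ closure (A '' (S : Set H)) :=
      image_closure_subset_closure_image A.continuous ⟨y, hy, rfl⟩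
    obtain ⟨_, ⟨_, ⟨q, rfl⟩, rfl⟩, hq⟩ := Metric.mem_closure_iff.1 hcl ε hε
    refine ⟨q.natDegree + 1, fun n hn => ?_⟩
    rw [dist_zero_right, hin]
    have : inner ℂ (A y) (u n) = inner ℂ (A y - A (L q)) (u n) := by
      rw [inner_sub_left, huo n q hn, sub_zero]
    rw [this]
    calc ‖inner ℂ (A y - A (L q)) (u n)‖ ≤ ‖A y - A (L q)‖ * ‖u n‖ := norm_inner_le_norm _ _
      _ ≤ ‖A y - A (L q)‖ * 1 := by gcongr; exact hu1 n
      _ < ε := by rwa [mul_one, ← dist_eq_norm]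
  have hlim := compact_weak C hC u hu1 hweak
  have hlim2 : Tendsto (fun k => M + c * ‖C (u k)‖) atTop (𝓝 M) := by
    simpa using (hlim.const_mul c).const_add M
  have hc0 : 0 ≤ c := by positivity
  rw [← hlim2.limsup_eq]
  refine limsup_le_limsup (Eventually.of_forall fun k => ?_) hcob hlim2.isBoundedUnder_le
  change _ / _ ≤ M + c * ‖C (u k)‖
  by_cases hz : L (p k) = 0
  · have : gmresRes (A : H →L[ℂ] H) r0 k = 0 := by rw [hpe]; exact norm_eq_zero.2 hz
    rw [this, div_zero]; positivity
  have hpos : 0 < ‖L (p k)‖ := norm_pos_iff.2 hz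
  have hCu : ‖C (u k)‖ = ‖L (p k)‖⁻¹ * ‖C (L (p k))‖ := by
    simp [u, norm_smul]
  rw [hpe k, div_le_iff₀ hpos, hCu]
  obtain ⟨α, hα⟩ := hstep (L (p k))
  refine (hnext k α).trans (hα.trans (le_of_eq ?_))
  field_simp
end

section
/- Let B ∈ ℂ^{N×N} be a non-singular matrix and let C ∈ ℂ^{N×N} be such that A = B + C is non-singular. Let M ∈ [0,1] be such that ‖r_k^{B,z}‖ ≤ M·‖r_{k-1}^{B,z}‖ for every z ∈ ℂ^N and every k ≥ 1. Then for every r0 ∈ ℂ^N and every k ≥ 1, ‖r_k^{A,r0}‖ ≤ (M + k^{-1/2}·(1+M)·‖A⁻¹‖·‖C‖_F)^k · ‖r0‖, where ‖A⁻¹‖ is the operator norm induced by the Euclidean norm and ‖C‖_F is the Frobenius norm of C. -/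
/-- Krylov spaces. -/
noncomputable def kry {H : Type*} [NormedAddCommGroup H] [NormedSpace ℂ H]
    (T : H →L[ℂ] H) (r0 : H) : ℕ → Submodule ℂ H
  | 0 => ⊥
  | (j + 1) => Submodule.span ℂ {r0} ⊔ (kry T r0 j).map (T : H →ₗ[ℂ] H)

theorem kry_poly {H : Type*} [NormedAddCommGroup H] [NormedSpace ℂ H]
    (T : H →L[ℂ] H) (r0 : H) (j : ℕ) : ∀ x ∈ kry T r0 j,
    ∃ q : Polynomial ℂ, (Polynomial.X * q).natDegree ≤ j ∧ Polynomial.aeval T q r0 = x := by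
  induction j with
  | zero =>
    intro x hx
    have : x = 0 := by simpa [kry] using hx
    exact ⟨0, by simp, by simp [this]⟩
  | succ j ih =>
    intro x hx
    obtain ⟨a, ha, b, hb, rfl⟩ := Submodule.mem_sup.1 hx
    obtain ⟨c, rfl⟩ := Submodule.mem_span_singleton.1 ha
    obtain ⟨y, hy, rfl⟩ := Submodule.mem_map.1 hb
    obtain ⟨q, hq, rfl⟩ := ih y hy
    refine ⟨Polynomial.C c + Polynomial.X * q, ?_, ?_⟩
    · refine Polynomial.natDegree_mul_le.trans ?_
      have h1 : (Polynomial.C c + Polynomial.X * q).natDegree ≤ j :=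
        (Polynomial.natDegree_add_le _ _).trans (by simp [hq])
      have := Polynomial.natDegree_X_le (R := ℂ)
      omega
    · simp [Algebra.algebraMap_eq_smul_one]

theorem gmresRes_bdd {H : Type*} [NormedAddCommGroup H] [NormedSpace ℂ H]
    (T : H →L[ℂ] H) (r0 : H) (k : ℕ) : BddBelow {x : ℝ | ∃ p : Polynomial ℂ,
    p.natDegree ≤ k ∧ p.eval 0 = 1 ∧ x = ‖(Polynomial.aeval T p) r0‖} :=
  ⟨0, by rintro _ ⟨p, -, -, rfl⟩; positivity⟩

theorem gmresRes_le {H : Type*} [NormedAddCommGroup H] [NormedSpace ℂ H]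
    (T : H →L[ℂ] H) (r0 : H) (k : ℕ) (v : H)
    (hv : v ∈ (kry T r0 k).map (T : H →ₗ[ℂ] H)) : gmresRes T r0 k ≤ ‖r0 - v‖ := by
  obtain ⟨y, hy, rfl⟩ := Submodule.mem_map.1 hv
  obtain ⟨q, hq, rfl⟩ := kry_poly T r0 k y hy
  refine csInf_le (gmresRes_bdd T r0 k) ⟨1 - Polynomial.X * q, ?_, by simp, by simp⟩
  exact (Polynomial.natDegree_sub_le _ _).trans (by simp [hq])

theorem kry_mono {H : Type*} [NormedAddCommGroup H] [NormedSpace ℂ H]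
    (T : H →L[ℂ] H) (r0 : H) (j : ℕ) : kry T r0 j ≤ kry T r0 (j + 1) := by
  induction j with
  | zero => simp [kry]
  | succ j ih => exact sup_le_sup_left (Submodule.map_mono ih) _

theorem le_of_sq_le_sq_aux {a b : ℝ} (h : a ^ 2 ≤ b ^ 2) (hb : 0 ≤ b) : a ≤ b :=
  (abs_le.1 (abs_le_of_sq_le_sq h hb)).2

section
variable {H : Type*} [NormedAddCommGroup H] [InnerProductSpace ℂ H]

/-- Symmetry of the sine of the angle. -/
theorem sine_symm (y z : H) (α : ℂ) (hz : z ≠ 0) :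
    ‖y - (inner ℂ z y / (‖z‖ : ℂ) ^ 2) • z‖ * ‖z‖ ≤ ‖z - α • y‖ * ‖y‖ := by
  have hz' : (‖z‖ : ℝ) ≠ 0 := by simpa using hz
  have hzc : (‖z‖ : ℂ) ≠ 0 := by exact_mod_cast hz'
  set β := inner ℂ z y / (‖z‖ : ℂ) ^ 2 with hβ
  set n := y - β • z with hn
  have hzz : inner ℂ z z = (‖z‖ : ℂ) ^ 2 := inner_self_eq_norm_sq_to_K z
  have horth : inner ℂ n z = 0 := by
    rw [inner_eq_zero_symm, hn, inner_sub_right, inner_smul_right, hzz, hβ]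
    field_simp
    simp
  have hy : y = n + β • z := by simp [hn]
  -- squares
  have key : (‖n‖ * ‖z‖) ^ 2 ≤ (‖z - α • y‖ * ‖y‖) ^ 2 := by
    have e1 : ‖y‖ ^ 2 = ‖n‖ ^ 2 + ‖β‖ ^ 2 * ‖z‖ ^ 2 := by
      have := norm_add_sq_eq_norm_sq_add_norm_sq_of_inner_eq_zero n (β • z)
        (by rw [inner_smul_right, horth, mul_zero])
      rw [← hy, norm_smul] at this
      nlinarith
    have e2 : ‖z - α • y‖ ^ 2 = ‖α‖ ^ 2 * ‖n‖ ^ 2 + ‖1 - α * β‖ ^ 2 * ‖z‖ ^ 2 := by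
      have := norm_add_sq_eq_norm_sq_add_norm_sq_of_inner_eq_zero ((-α) • n) ((1 - α * β) • z)
        (by rw [inner_smul_right, inner_smul_left, horth, mul_zero, mul_zero])
      have e : (-α) • n + (1 - α * β) • z = z - α • y := by
        rw [hy]; module
      rw [e, norm_smul, norm_smul, norm_neg] at this
      nlinarith
    have e3 : 1 ≤ ‖1 - α * β‖ + ‖α‖ * ‖β‖ := by
      have := norm_add_le (1 - α * β) (α * β)
      simpa using this
    rw [mul_pow, mul_pow, e1, e2]
    have ha := norm_nonneg α
    have hb := norm_nonneg β
    have hc := norm_nonneg (1 - α * β)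
    generalize ‖α‖ = a at *
    generalize ‖β‖ = b at *
    generalize ‖1 - α * β‖ = c at *
    have hp : 0 ≤ ‖n‖ ^ 2 := by positivity
    generalize ‖n‖ ^ 2 = p at *
    have hq : 0 ≤ ‖z‖ ^ 2 := by positivity
    generalize ‖z‖ ^ 2 = q at *
    -- (a²p + c²q)(p + b²q) ≥ pq
    have h1 : 1 ≤ (c + a * b) ^ 2 := by nlinarith [mul_nonneg ha hb]
    have h2 : p * q * 1 ≤ p * q * (c + a * b) ^ 2 :=
      mul_le_mul_of_nonneg_left h1 (mul_nonneg hp hq)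
    nlinarith [sq_nonneg (a * p - c * b * q)]
  exact (pow_le_pow_iff_left₀ (by positivity) (by positivity) two_ne_zero).1 key

theorem B_bound (B : H →L[ℂ] H) (M : ℝ) (hM0 : 0 ≤ M) (hlin : ∀ z : H, gmresRes B z 1 ≤ M * gmresRes B z 0)
    (z : H) : ∃ β : ℂ, ‖B z - β • z‖ ≤ M * ‖B z‖ := by
  by_cases hz : z = 0
  · exact ⟨0, by simp [hz]⟩
  by_cases hy : B z = 0
  · exact ⟨0, by simp [hy]⟩
  refine ⟨inner ℂ z (B z) / (‖z‖ : ℂ) ^ 2, ?_⟩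
  have hz' : 0 < ‖z‖ := by simpa using hz
  have hy' : 0 < ‖B z‖ := by simpa using hy
  have h0 : gmresRes B z 0 ≤ ‖z‖ :=
    csInf_le (gmresRes_bdd B z 0) ⟨1, by simp, by simp, by simp⟩
  have h1 : ‖B z - (inner ℂ z (B z) / (‖z‖ : ℂ) ^ 2) • z‖ * ‖z‖ / ‖B z‖ ≤ gmresRes B z 1 := by
    refine le_csInf ⟨_, 1, by simp, by simp, rfl⟩ ?_
    rintro _ ⟨p, hp, hp1, rfl⟩
    rw [div_le_iff₀ hy']
    obtain ⟨a, b, rfl⟩ := Polynomial.exists_eq_X_add_C_of_natDegree_le_one hp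
    have hb : b = 1 := by simpa using hp1
    subst hb
    have := sine_symm (B z) z (-a) hz
    have e : (Polynomial.aeval B (Polynomial.C a * Polynomial.X + Polynomial.C 1)) z =
        z - (-a) • B z := by
      simp [Algebra.algebraMap_eq_smul_one, add_comm]
    rw [e]
    exact this
  have h2 := h1.trans ((hlin z).trans (mul_le_mul_of_nonneg_left h0 hM0))
  rw [div_le_iff₀ hy'] at h2
  refine le_of_mul_le_mul_right ?_ hz'
  linarith

theorem exists_w [FiniteDimensional ℂ H] (T : H →L[ℂ] H) (hT : Function.Injective T) (r0 : H) (j : ℕ)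
    (hr : r0 ∉ (kry T r0 j).map (T : H →ₗ[ℂ] H)) :
    ∃ w ∈ (kry T r0 (j + 1)).map (T : H →ₗ[ℂ] H), ‖w‖ = 1 ∧
      ∀ v ∈ (kry T r0 j).map (T : H →ₗ[ℂ] H), inner ℂ v w = 0 := by
  set V := (kry T r0 j).map (T : H →ₗ[ℂ] H) with hV
  have hT' : Function.Injective (T : H →ₗ[ℂ] H) := hT
  have hle : V ≤ (kry T r0 (j + 1)).map (T : H →ₗ[ℂ] H) := Submodule.map_mono (kry_mono T r0 j)
  have hne : ¬ (kry T r0 (j + 1)).map (T : H →ₗ[ℂ] H) ≤ V := by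
    intro h
    have e : kry T r0 j = kry T r0 (j + 1) := Submodule.map_injective_of_injective hT' (le_antisymm hle h)
    have hsub : V ≤ kry T r0 (j + 1) := le_sup_right
    have hfin : Module.finrank ℂ V = Module.finrank ℂ (kry T r0 (j + 1)) := by
      rw [← e]
      exact (Submodule.equivMapOfInjective _ hT' _).finrank_eq.symm
    have := Submodule.eq_of_le_of_finrank_eq hsub hfin
    apply hr
    rw [this]
    exact Submodule.mem_sup_left (Submodule.mem_span_singleton_self r0)
  obtain ⟨x, hx, hxV⟩ := Set.not_subset.1 hne
  have hne0 : x - V.starProjection x ≠ 0 := by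
    intro h
    apply hxV
    rw [sub_eq_zero.1 h]
    exact Submodule.starProjection_apply_mem V x
  refine ⟨((‖x - V.starProjection x‖⁻¹ : ℝ) : ℂ) • (x - V.starProjection x), ?_, ?_, ?_⟩
  · exact Submodule.smul_mem _ _ (Submodule.sub_mem _ hx (hle (Submodule.starProjection_apply_mem V x)))
  · rw [norm_smul]
    have : ‖x - V.starProjection x‖ ≠ 0 := by simpa using hne0
    simp [this]
  · intro v hv
    rw [inner_smul_right]
    have := Submodule.sub_starProjection_mem_orthogonal (K := V) x
    rw [(Submodule.mem_orthogonal _ _).1 this v hv, mul_zero]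

theorem step [FiniteDimensional ℂ H] (T B C S : H →L[ℂ] H) (hTB : T = B + C)
    (hST : ∀ x, S (T x) = x) (M : ℝ) (hM0 : 0 ≤ M)
    (hB : ∀ z : H, ∃ β : ℂ, ‖B z - β • z‖ ≤ M * ‖B z‖)
    (r0 : H) (j : ℕ) (w : H)
    (hw : w ∈ (kry T r0 (j + 1)).map (T : H →ₗ[ℂ] H)) (hw1 : ‖w‖ = 1)
    (hwV : ∀ v ∈ (kry T r0 j).map (T : H →ₗ[ℂ] H), inner ℂ v w = 0) :
    ‖r0 - ((kry T r0 (j + 1)).map (T : H →ₗ[ℂ] H)).starProjection r0‖ ≤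
      (M + (1 + M) * ‖C (S w)‖) *
        ‖r0 - ((kry T r0 j).map (T : H →ₗ[ℂ] H)).starProjection r0‖ := by
  set V := (kry T r0 j).map (T : H →ₗ[ℂ] H) with hV
  set W := (kry T r0 (j + 1)).map (T : H →ₗ[ℂ] H) with hW
  have hle : V ≤ W := Submodule.map_mono (kry_mono T r0 j)
  set r := r0 - V.starProjection r0 with hrdef
  have hrV : r ∈ Vᗮ := Submodule.sub_starProjection_mem_orthogonal (K := V) r0
  have hwV' : w ∈ Vᗮ := (Submodule.mem_orthogonal _ _).2 hwV
  have hw0 : w ≠ 0 := by rintro rfl; simp at hw1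
  obtain ⟨x, hx, rfl⟩ := Submodule.mem_map.1 hw
  simp only [ContinuousLinearMap.coe_coe] at *
  rw [hST]
  -- angle
  obtain ⟨β, hβ⟩ := hB x
  have h1 : ‖T x - β • x‖ ≤ M + (1 + M) * ‖C x‖ := by
    have e1 : T x - β • x = (B x - β • x) + C x := by rw [hTB]; simp; abel
    have e2 : ‖B x‖ ≤ 1 + ‖C x‖ := by
      have : B x = T x - C x := by rw [hTB]; simp
      rw [this, ← hw1]; exact norm_sub_le _ _
    rw [e1]
    have := norm_add_le (B x - β • x) (C x)
    nlinarith [mul_le_mul_of_nonneg_left e2 hM0]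
  obtain ⟨a, ha, v, hv, hav⟩ := Submodule.mem_sup.1 hx
  obtain ⟨c, rfl⟩ := Submodule.mem_span_singleton.1 ha
  have h2 : ‖T x - (β * c) • r‖ ≤ ‖T x - β • x‖ := by
    have hmem : T x - (β * c) • r ∈ Vᗮ := Submodule.sub_mem _ hwV' (Submodule.smul_mem _ _ hrV)
    have hv' : β • v + (β * c) • V.starProjection r0 ∈ V :=
      V.add_mem (V.smul_mem _ hv) (V.smul_mem _ (Submodule.starProjection_apply_mem V r0))
    have e : T x - β • x = (T x - (β * c) • r) - (β • v + (β * c) • V.starProjection r0) := by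
      rw [← hav, hrdef]; module
    have := norm_add_sq_eq_norm_sq_add_norm_sq_of_inner_eq_zero (𝕜 := ℂ) _ _
      (Submodule.inner_left_of_mem_orthogonal (V.neg_mem hv') hmem)
    rw [← sub_eq_add_neg, ← e] at this
    refine le_of_sq_le_sq_aux ?_ (norm_nonneg _)
    nlinarith [mul_self_nonneg ‖-(β • v + (β * c) • V.starProjection r0)‖]
  have h3 := sine_symm r (T x) (β * c) hw0
  rw [hw1, mul_one] at h3
  refine le_trans ?_ (h3.trans (mul_le_mul_of_nonneg_right (h2.trans h1) (norm_nonneg _)))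
  -- minimality
  set d := (inner ℂ (T x) r / ((1 : ℝ) : ℂ) ^ 2) with hd
  have hu : V.starProjection r0 + d • T x ∈ W :=
    W.add_mem (hle (Submodule.starProjection_apply_mem V r0)) (W.smul_mem _ hw)
  have e : r - d • T x = (r0 - W.starProjection r0) +
      (W.starProjection r0 - (V.starProjection r0 + d • T x)) := by
    rw [hrdef]; abel
  have := norm_add_sq_eq_norm_sq_add_norm_sq_of_inner_eq_zero (𝕜 := ℂ) _ _
      (Submodule.inner_left_of_mem_orthogonal 
        (W.sub_mem (Submodule.starProjection_apply_mem W r0) hu)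
        (Submodule.sub_starProjection_mem_orthogonal (K := W) r0))
  rw [← e] at this
  refine le_of_sq_le_sq_aux ?_ (norm_nonneg _)
  nlinarith [mul_self_nonneg ‖W.starProjection r0 - (V.starProjection r0 + d • T x)‖]

end

theorem amgm (k : ℕ) (hk : 1 ≤ k) (s : ℕ → ℝ) (M D F : ℝ) (hs : ∀ i, 0 ≤ s i) (hM : 0 ≤ M)
    (hD : 0 ≤ D) (hF : 0 ≤ F) (hsum : ∑ i ∈ Finset.range k, s i ^ 2 ≤ F ^ 2) :
    ∏ i ∈ Finset.range k, (M + D * s i) ≤ (M + (k : ℝ) ^ (-(1 / 2) : ℝ) * D * F) ^ k := by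
  have hk0 : (0 : ℝ) < k := by exact_mod_cast hk
  have hpos : ∀ i, 0 ≤ M + D * s i := fun i => add_nonneg hM (mul_nonneg hD (hs i))
  have h := Real.geom_mean_le_arith_mean (Finset.range k) (fun _ => (1 : ℝ))
    (fun i => M + D * s i) (by simp) (by simpa using (show 0 < k by omega)) (fun i _ => hpos i)
  simp only [Real.rpow_one, Finset.sum_const, Finset.card_range, nsmul_eq_mul, mul_one,
    one_mul] at h
  have hP : 0 ≤ ∏ i ∈ Finset.range k, (M + D * s i) := Finset.prod_nonneg fun i _ => hpos i
  have h1 : ∏ i ∈ Finset.range k, (M + D * s i) =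
      ((∏ i ∈ Finset.range k, (M + D * s i)) ^ (k : ℝ)⁻¹) ^ k := by
    rw [Real.rpow_inv_natCast_pow hP (by omega)]
  rw [h1]
  refine pow_le_pow_left₀ (Real.rpow_nonneg hP _) (h.trans ?_) k
  rw [Finset.sum_add_distrib, ← Finset.mul_sum]
  simp only [Finset.sum_const, Finset.card_range, nsmul_eq_mul]
  have hrp : (k : ℝ) ^ (-(1 / 2) : ℝ) = (Real.sqrt k)⁻¹ := by
    rw [Real.rpow_neg hk0.le, Real.sqrt_eq_rpow]
  have hsq : 0 < Real.sqrt k := Real.sqrt_pos.2 hk0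
  have hss : Real.sqrt k * Real.sqrt k = k := Real.mul_self_sqrt hk0.le
  have hcs : ∑ i ∈ Finset.range k, s i ≤ Real.sqrt k * F := by
    refine le_of_sq_le_sq_aux ?_ (by positivity)
    have := sq_sum_le_card_mul_sum_sq (s := Finset.range k) (f := s)
    rw [Finset.card_range] at this
    rw [mul_pow, Real.sq_sqrt hk0.le]
    exact this.trans (mul_le_mul_of_nonneg_left hsum hk0.le)
  rw [hrp, div_le_iff₀ hk0]
  have e : (M + (Real.sqrt k)⁻¹ * D * F) * k = k * M + D * (Real.sqrt k * F) := by
    have e2 : (Real.sqrt k)⁻¹ * k = Real.sqrt k := by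
      rw [inv_mul_eq_iff_eq_mul₀ hsq.ne', hss]
    linear_combination (D * F) * e2
  rw [e]
  have := mul_le_mul_of_nonneg_left hcs hD
  linarith

theorem frob {N k : ℕ} (C : Matrix (Fin N) (Fin N) ℂ)
    (S : EuclideanSpace ℂ (Fin N) →L[ℂ] EuclideanSpace ℂ (Fin N))
    (w : Fin k → EuclideanSpace ℂ (Fin N)) (hw : Orthonormal ℂ w) :
    ∑ j, ‖Matrix.toEuclideanCLM (𝕜 := ℂ) C (S (w j))‖ ^ 2 ≤
      ‖S‖ ^ 2 * ∑ i, ∑ j, ‖C i j‖ ^ 2 := by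
  let c : Fin N → EuclideanSpace ℂ (Fin N) := fun i => WithLp.toLp 2 (fun j => star (C i j))
  have hc : ∀ i x, (Matrix.toEuclideanCLM (𝕜 := ℂ) C x) i = inner ℂ (c i) x := by
    intro i x
    simp [c, PiLp.inner_apply, Matrix.mulVec, dotProduct, mul_comm]
  calc ∑ j, ‖Matrix.toEuclideanCLM (𝕜 := ℂ) C (S (w j))‖ ^ 2
      = ∑ j, ∑ i, ‖inner ℂ (w j) (ContinuousLinearMap.adjoint S (c i))‖ ^ 2 := by
        refine Finset.sum_congr rfl fun j _ => ?_
        rw [EuclideanSpace.norm_sq_eq]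
        refine Finset.sum_congr rfl fun i _ => ?_
        rw [hc, ContinuousLinearMap.adjoint_inner_right, norm_inner_symm]
    _ = ∑ i, ∑ j, ‖inner ℂ (w j) (ContinuousLinearMap.adjoint S (c i))‖ ^ 2 := Finset.sum_comm
    _ ≤ ∑ i, ‖S‖ ^ 2 * ∑ j, ‖C i j‖ ^ 2 := by
        refine Finset.sum_le_sum fun i _ => ?_
        refine (hw.sum_inner_products_le (s := Finset.univ) _).trans ?_
        have h1 : ‖ContinuousLinearMap.adjoint S (c i)‖ ≤ ‖S‖ * ‖c i‖ := by
          have := (ContinuousLinearMap.adjoint S).le_opNorm (c i)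
          rwa [LinearIsometryEquiv.norm_map] at this
        have h2 : ‖c i‖ ^ 2 = ∑ j, ‖C i j‖ ^ 2 := by
          rw [EuclideanSpace.norm_sq_eq]; simp [c]
        rw [← h2, ← mul_pow]
        exact pow_le_pow_left₀ (norm_nonneg _) h1 2
    _ = _ := by rw [Finset.mul_sum]

/-- Corollary 1.2: the finite-dimensional variant, with the Frobenius norm of
the perturbation. -/
theorem gmres_matrix_perturbation_rate {N : ℕ}
    (B C A : Matrix (Fin N) (Fin N) ℂ)
    (hB : IsUnit B.det) (hA : A = B + C) (hAunit : IsUnit A.det)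
    (M : ℝ) (hM0 : 0 ≤ M) (hM1 : M ≤ 1)
    (hlin : ∀ (z : EuclideanSpace ℂ (Fin N)) (k : ℕ),
      gmresRes (Matrix.toEuclideanCLM (𝕜 := ℂ) B) z (k + 1) ≤
        M * gmresRes (Matrix.toEuclideanCLM (𝕜 := ℂ) B) z k)
    (r0 : EuclideanSpace ℂ (Fin N)) (k : ℕ) (hk : 1 ≤ k) :
    gmresRes (Matrix.toEuclideanCLM (𝕜 := ℂ) A) r0 k ≤
      (M + (k : ℝ) ^ (-(1 / 2) : ℝ) * (1 + M) *
          ‖Matrix.toEuclideanCLM (𝕜 := ℂ) A⁻¹‖ *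
          Real.sqrt (∑ i, ∑ j, ‖C i j‖ ^ 2)) ^ k * ‖r0‖ := by
  subst hA
  set A := B + C with hAdef
  set T := Matrix.toEuclideanCLM (𝕜 := ℂ) A with hT
  set S := Matrix.toEuclideanCLM (𝕜 := ℂ) A⁻¹ with hS
  have hST : ∀ x, S (T x) = x := by
    intro x
    have : S * T = 1 := by
      rw [hS, hT, ← map_mul, Matrix.nonsing_inv_mul _ hAunit, map_one]
    calc S (T x) = (S * T) x := rfl
      _ = x := by rw [this]; rfl
  have hTi : Function.Injective T := Function.LeftInverse.injective hST
  have hTB : T = Matrix.toEuclideanCLM (𝕜 := ℂ) B + Matrix.toEuclideanCLM (𝕜 := ℂ) C := by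
    rw [hT, hAdef, map_add]
  have hBb := B_bound (Matrix.toEuclideanCLM (𝕜 := ℂ) B) M hM0 (fun z => hlin z 0)
  by_cases hr : r0 ∈ (kry T r0 k).map (T : EuclideanSpace ℂ (Fin N) →ₗ[ℂ] EuclideanSpace ℂ (Fin N))
  · refine (gmresRes_le T r0 k r0 hr).trans ?_
    rw [sub_self, norm_zero]
    positivity
  have hVm : Monotone fun j => (kry T r0 j).map (T : EuclideanSpace ℂ (Fin N) →ₗ[ℂ] EuclideanSpace ℂ (Fin N)) :=
    monotone_nat_of_le_succ fun j => Submodule.map_mono (kry_mono T r0 j)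
  have hrj : ∀ j : Fin k, r0 ∉ (kry T r0 j).map (T : EuclideanSpace ℂ (Fin N) →ₗ[ℂ] EuclideanSpace ℂ (Fin N)) :=
    fun j h => hr (hVm j.2.le h)
  choose w hw hw1 hwV using fun j : Fin k => exists_w T hTi r0 j (hrj j)
  have hon : Orthonormal ℂ w := by
    refine ⟨hw1, ?_⟩
    have hlt : ∀ i j : Fin k, i < j → inner ℂ (w i) (w j) = 0 := fun i j hij =>
      hwV j _ (hVm (Nat.succ_le_of_lt hij) (hw i))
    intro i j hij
    rcases lt_or_gt_of_ne hij with h | h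
    · exact hlt i j h
    · exact inner_eq_zero_symm.1 (hlt j i h)
  set s : ℕ → ℝ := fun j => if h : j < k then
    ‖Matrix.toEuclideanCLM (𝕜 := ℂ) C (S (w ⟨j, h⟩))‖ else 0 with hs
  have hs0 : ∀ i, 0 ≤ s i := by
    intro i; simp only [hs]; split_ifs <;> positivity
  have hprod : ∀ j ≤ k, ‖r0 - ((kry T r0 j).map (T : EuclideanSpace ℂ (Fin N) →ₗ[ℂ] EuclideanSpace ℂ (Fin N))).starProjection r0‖ ≤
      (∏ i ∈ Finset.range j, (M + (1 + M) * s i)) * ‖r0‖ := by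
    intro j
    induction j with
    | zero => intro _; simp [kry]
    | succ j ih =>
      intro hj
      have h1 := step T _ _ S hTB hST M hM0 hBb r0 j _ (hw ⟨j, hj⟩) (hw1 ⟨j, hj⟩)
        (hwV ⟨j, hj⟩)
      have e : s j = ‖Matrix.toEuclideanCLM (𝕜 := ℂ) C (S (w ⟨j, hj⟩))‖ := by
        simp only [hs]; rw [dif_pos]
      rw [← e] at h1
      refine h1.trans ?_
      rw [Finset.prod_range_succ]
      have := mul_le_mul_of_nonneg_left (ih (by omega))
        (show 0 ≤ M + (1 + M) * s j by have := hs0 j; positivity)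
      linarith
  have hsum : ∑ i ∈ Finset.range k, s i ^ 2 ≤
      (‖S‖ * Real.sqrt (∑ i, ∑ j, ‖C i j‖ ^ 2)) ^ 2 := by
    rw [mul_pow, Real.sq_sqrt (by positivity), Finset.sum_range]
    refine le_trans (le_of_eq ?_) (frob C S w hon)
    refine Finset.sum_congr rfl fun j _ => ?_
    simp [hs]
  have hfin := amgm k hk s M (1 + M) _ hs0 hM0 (by positivity)
    (by positivity) hsum
  refine (gmresRes_le T r0 k _ (Submodule.starProjection_apply_mem _ r0)).trans
    ((hprod k le_rfl).trans (mul_le_mul_of_nonneg_right (hfin.trans (le_of_eq ?_)) (norm_nonneg _)))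
  ring
end
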